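/- Let (X,d_X) be a compact connected geodesic space, r ∈ X, and suppose the metric Reeb graph (G,d_G) of d = d_X(r,·) is a finite graph. If there exists a finite metric graph (G',d_{G'}) with d_GH(X,G') < ε, then d_GH(X,G) < (β_1(G)+1)·(17 + 8·N_{E,G'}(8ε))·ε, where N_{E,G'}(8ε) is the number of edges of G' of length at most 8ε. In particular, if every edge of G' has length greater than 8ε, then d_GH(X,G) < 17·(β_1(G)+1)·ε. -/

import Mathlib

open Set Metric

noncomputable section

/-- A finite metric graph structure on a metric space `G`: a finite set of edges, each
isometrically parametrized by arc length on `[0, len e]`, covering `G`, with pairwise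
disjoint open edges, and such that the metric of `G` is the associated shortest-path
metric (i.e. the largest pseudometric making all edge parametrizations 1-Lipschitz). -/
structure MetricGraphStruct (G : Type*) [MetricSpace G] where
  /-- the (finite) index type of edges -/
  E : Type
  fintypeE : Fintype E
  /-- length of each edge -/
  len : E → ℝ
  len_pos : ∀ e, 0 < len e
  /-- arc-length parametrization of each edge on `[0, len e]` -/
  param : E → ℝ → G
  param_lipschitz : ∀ e, LipschitzOnWith 1 (param e) (Set.Icc 0 (len e))
  /-- the edges cover `G` -/
  cover : ∀ x : G, ∃ e, ∃ t ∈ Set.Icc 0 (len e), param e t = x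
  /-- each open edge is simple -/
  injOn : ∀ e, Set.InjOn (param e) (Set.Ioo 0 (len e))
  /-- open edges are pairwise disjoint -/
  disjoint_interiors : ∀ e₁ e₂, e₁ ≠ e₂ → ∀ s ∈ Set.Ioo 0 (len e₁), ∀ t ∈ Set.Ioo 0 (len e₂),
    param e₁ s ≠ param e₂ t
  /-- endpoints of edges do not lie in open edges -/
  endpoint_not_interior : ∀ e e', ∀ t ∈ Set.Ioo 0 (len e'),
    param e 0 ≠ param e' t ∧ param e (len e) ≠ param e' t
  /-- the metric of `G` is the shortest-path metric: it is maximal among pseudometrics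
  making every edge parametrization 1-Lipschitz -/
  dist_maximal : ∀ δ : G → G → ℝ, (∀ p, δ p p = 0) → (∀ p q, δ p q = δ q p) →
    (∀ p q s, δ p s ≤ δ p q + δ q s) →
    (∀ e, ∀ s ∈ Set.Icc 0 (len e), ∀ t ∈ Set.Icc 0 (len e),
      δ (param e s) (param e t) ≤ |s - t|) →
    ∀ p q, δ p q ≤ dist p q

namespace MetricGraphStruct

variable {G : Type*} [MetricSpace G] (M : MetricGraphStruct G)

/-- first endpoint of an edge -/
def src (e : M.E) : G := M.param e 0

/-- second endpoint of an edge -/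
def tgt (e : M.E) : G := M.param e (M.len e)

/-- the set of vertices (endpoints of edges) -/
def vertexSet : Set G := {v | ∃ e, v = M.src e ∨ v = M.tgt e}

/-- `N_E(α)`: the number of edges of length at most `α` -/
def NE (α : ℝ) : ℕ := Nat.card {e : M.E // M.len e ≤ α}

/-- the first Betti number of a connected finite graph: `#E - #V + 1` -/
def betti1 : ℕ := Nat.card M.E + 1 - Nat.card M.vertexSet

end MetricGraphStruct

end

/-- A geodesic metric space: any two points are joined by an isometrically embedded
segment. -/
def IsGeodesicSpace (X : Type*) [MetricSpace X] : Prop :=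
  ∀ x y : X, ∃ γ : ℝ → X, γ 0 = x ∧ γ (dist x y) = y ∧
    ∀ s ∈ Set.Icc 0 (dist x y), ∀ t ∈ Set.Icc 0 (dist x y), dist (γ s) (γ t) = |s - t|

/-- The Reeb relation of the distance function `d = d_X(r, ·)`: two points are related if
they have the same distance to `r` and lie in the same path-connected component of the
corresponding level set of `d`. -/
def reebRel {X : Type*} [MetricSpace X] (r : X) (x y : X) : Prop :=
  dist r x = dist r y ∧ JoinedIn {z | dist r z = dist r x} x y

/-- `G` is the metric Reeb graph of the distance function `d = d_X(r, ·)` on `X`: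
`π : X → G` is the (continuous, surjective) quotient map of the Reeb relation, `d`
factors as `d_* ∘ π`, and `G` carries a finite metric graph structure whose edges are
parametrized so that `d_*` increases at unit speed along each edge (hence each edge has
length the variation of `d_*` along it), the metric on `G` being the associated
shortest-path metric. -/
structure ReebGraphOf (X : Type*) [MetricSpace X] (r : X)
    (G : Type*) [MetricSpace G] where
  /-- the finite metric graph structure on `G` -/
  graph : MetricGraphStruct G
  /-- the quotient map -/
  π : X → G
  continuous_π : Continuous π
  surj : Function.Surjective π
  /-- `π` identifies exactly the points equivalent under the Reeb relation -/
  eq_iff : ∀ x y : X, π x = π y ↔ reebRel r x y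
  /-- the function induced by `d` on the quotient -/
  dStar : G → ℝ
  dStar_π : ∀ x : X, dStar (π x) = dist r x
  /-- `d_*` increases at unit speed along each (oriented) edge -/
  dStar_param : ∀ e : graph.E, ∀ t ∈ Set.Icc 0 (graph.len e),
    dStar (graph.param e t) = dStar (graph.param e 0) + t

namespace ReebGraphOf

variable {X : Type*} [MetricSpace X] {r : X} {G : Type*} [MetricSpace G]

/-- A merging vertex: a point of `G` which is the terminal endpoint of at least two
distinct edges (edges being oriented by increasing `d_*`). -/
def IsMergingVertex (R : ReebGraphOf X r G) (v : G) : Prop :=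
  ∃ e₁ e₂ : R.graph.E, e₁ ≠ e₂ ∧ R.graph.tgt e₁ = v ∧ R.graph.tgt e₂ = v

/-- `M`: the supremum of the diameters of the fibers of `π`. -/
noncomputable def fiberDiamSup (R : ReebGraphOf X r G) : ℝ := ⨆ p : G, Metric.diam (R.π ⁻¹' {p})

end ReebGraphOf

theorem abs_dist_sub_dist_le {α : Type*} [MetricSpace α] (a x y : α) :
    |dist a x - dist a y| ≤ dist x y :=
  dist_dist_dist_le_right a x y

namespace MetricGraphStruct

open Filter Topology

variable {G : Type*} [MetricSpace G] (M : MetricGraphStruct G)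

theorem finite_vertexSet : M.vertexSet.Finite := by
  have := M.fintypeE
  refine ((finite_range M.src).union (finite_range M.tgt)).subset ?_
  rintro v ⟨e, rfl | rfl⟩
  · exact Or.inl ⟨e, rfl⟩
  · exact Or.inr ⟨e, rfl⟩

theorem dist_param_le (e : M.E) {s t : ℝ} (hs : s ∈ Icc 0 (M.len e)) (ht : t ∈ Icc 0 (M.len e)) :
    dist (M.param e s) (M.param e t) ≤ |s - t| := by
  have h := (M.param_lipschitz e).dist_le_mul s hs t ht
  simpa [Real.dist_eq] using h

/-- `M.EdgeChain p q L`: one can go from `p` to `q` through finitely many edge segments of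
total length `L`. -/
inductive EdgeChain (p : G) : G → ℝ → Prop
  | refl : EdgeChain p p 0
  | step {q q' : G} {L : ℝ} (h : EdgeChain p q L) (e : M.E) {s t : ℝ}
      (hs : s ∈ Icc 0 (M.len e)) (ht : t ∈ Icc 0 (M.len e)) (hq : q = M.param e s)
      (hq' : q' = M.param e t) : EdgeChain p q' (L + |s - t|)

variable {M}

theorem EdgeChain.nonneg {p q : G} {L : ℝ} (h : M.EdgeChain p q L) : 0 ≤ L := by
  induction h with
  | refl => exact le_rfl
  | step _ _ _ _ _ _ ih => positivity

theorem exists_edgeChain {p q : G} {C : ℝ} (hC : dist p q < C) :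
    ∃ L < C, M.EdgeChain p q L := by
  have hC0 : 0 < C := dist_nonneg.trans_lt hC
  set S : G → Set ℝ := fun q => insert C {L | M.EdgeChain p q L} with hS
  have hne : ∀ q, (S q).Nonempty := fun q => ⟨C, mem_insert _ _⟩
  have hnn : ∀ q, ∀ L ∈ S q, 0 ≤ L := by
    rintro q L (rfl | h)
    · exact hC0.le
    · exact h.nonneg
  have hbdd : ∀ q, BddBelow (S q) := fun q => ⟨0, hnn q⟩
  have hstep : ∀ e, ∀ s ∈ Icc 0 (M.len e), ∀ t ∈ Icc 0 (M.len e),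
      sInf (S (M.param e t)) ≤ sInf (S (M.param e s)) + |s - t| := by
    intro e s hs t ht
    rw [← sub_le_iff_le_add]
    refine le_csInf (hne _) ?_
    rintro L (rfl | h)
    · have := csInf_le (hbdd (M.param e t)) (mem_insert L _)
      have := abs_nonneg (s - t)
      linarith
    · have := csInf_le (hbdd (M.param e t)) (mem_insert_of_mem C (EdgeChain.step h e hs ht rfl rfl))
      linarith
  have key := M.dist_maximal (fun a b => |sInf (S a) - sInf (S b)|) (by simp)
    (fun a b => abs_sub_comm _ _) (fun a b c => abs_sub_le _ _ _)
    (fun e s hs t ht => by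
      have h1 := hstep e s hs t ht
      have h2 := hstep e t ht s hs
      rw [abs_sub_comm t s] at h2
      exact abs_le.2 ⟨by linarith, by linarith⟩) p q
  have hp : sInf (S p) ≤ 0 := csInf_le (hbdd p) (mem_insert_of_mem C EdgeChain.refl)
  have hlt : sInf (S q) < C := by
    have := neg_abs_le (sInf (S p) - sInf (S q))
    linarith
  obtain ⟨L, hL, hLC⟩ := exists_lt_of_csInf_lt (hne q) hlt
  rcases hL with rfl | hL
  · exact absurd hLC (lt_irrefl _)
  · exact ⟨L, hLC, hL⟩

theorem eq_of_param_eq_interior {e e' : M.E} {s t : ℝ} (hs : s ∈ Ioo 0 (M.len e))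
    (ht : t ∈ Icc 0 (M.len e')) (h : M.param e s = M.param e' t) : e' = e ∧ t = s := by
  rcases eq_or_lt_of_le ht.1 with rfl | h0
  · exact absurd h.symm (M.endpoint_not_interior e' e s hs).1
  rcases eq_or_lt_of_le ht.2 with rfl | h1
  · exact absurd h.symm (M.endpoint_not_interior e' e s hs).2
  by_cases hee : e' = e
  · subst hee
    exact ⟨rfl, M.injOn e' ⟨h0, h1⟩ hs h.symm⟩
  · exact absurd h.symm (M.disjoint_interiors e' e hee t ⟨h0, h1⟩ s hs)

theorem EdgeChain.exit {e : M.E} {α β u : ℝ} (h0 : 0 ≤ α) (hα : α ≤ u) (hβ : u ≤ β)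
    (h1 : β ≤ M.len e) {q : G} {L : ℝ} (h : M.EdgeChain (M.param e u) q L) :
    (∃ t ∈ Icc α β, q = M.param e t ∧ |u - t| ≤ L) ∨ u - α + dist (M.param e α) q ≤ L ∨
      β - u + dist (M.param e β) q ≤ L := by
  have hαmem : α ∈ Icc 0 (M.len e) := ⟨h0, by linarith⟩
  have hβmem : β ∈ Icc 0 (M.len e) := ⟨by linarith, h1⟩
  induction h with
  | refl => exact Or.inl ⟨u, ⟨hα, hβ⟩, rfl, by simp⟩
  | @step q q' L h e' s t hs ht hq hq' ih =>
    have hd : dist q q' ≤ |s - t| := hq ▸ hq' ▸ M.dist_param_le e' hs ht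
    rcases ih with ⟨t₀, ht₀, hqt, hL⟩ | ih | ih
    · rcases eq_or_lt_of_le ht₀.1 with rfl | ha
      · right; left
        rw [abs_of_nonneg (by linarith)] at hL
        rw [← hqt]; linarith
      rcases eq_or_lt_of_le ht₀.2 with rfl | hb
      · right; right
        rw [abs_of_nonpos (by linarith)] at hL
        rw [← hqt]; linarith
      obtain ⟨rfl, rfl⟩ := eq_of_param_eq_interior (M := M)
        (⟨by linarith, by linarith⟩ : t₀ ∈ Ioo 0 (M.len e)) hs (hqt.symm.trans hq)
      have hut := abs_sub_le u s t
      rcases lt_or_ge t α with hlt | hge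
      · right; left
        have := M.dist_param_le e' hαmem ht
        rw [abs_of_nonneg (by linarith)] at this
        have := le_abs_self (u - t)
        rw [hq']; linarith
      rcases lt_or_ge β t with hlt' | hge'
      · right; right
        have := M.dist_param_le e' hβmem ht
        rw [abs_of_nonpos (by linarith)] at this
        have := neg_abs_le (u - t)
        rw [hq']; linarith
      · exact Or.inl ⟨t, ⟨hge, hge'⟩, hq', by linarith⟩
    · right; left
      linarith [dist_triangle (M.param e α) q q']
    · right; right
      linarith [dist_triangle (M.param e β) q q']

theorem exit_of_dist_lt {e : M.E} {α β u : ℝ} (h0 : 0 ≤ α) (hα : α ≤ u) (hβ : u ≤ β)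
    (h1 : β ≤ M.len e) {q : G} {C : ℝ} (h : dist (M.param e u) q < C) :
    (∃ t ∈ Icc α β, q = M.param e t ∧ |u - t| < C) ∨ u - α + dist (M.param e α) q < C ∨
      β - u + dist (M.param e β) q < C := by
  obtain ⟨L, hL, hc⟩ := exists_edgeChain (M := M) h
  rcases hc.exit h0 hα hβ h1 with ⟨t, ht, hq, hl⟩ | h | h
  · exact Or.inl ⟨t, ht, hq, hl.trans_lt hL⟩
  · exact Or.inr (Or.inl (h.trans_lt hL))
  · exact Or.inr (Or.inr (h.trans_lt hL))

theorem abs_dist_param_sub_le (a : G) (e : M.E) {s t : ℝ} (hs : s ∈ Icc 0 (M.len e))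
    (ht : t ∈ Icc 0 (M.len e)) : |dist a (M.param e s) - dist a (M.param e t)| ≤ |s - t| :=
  (abs_dist_sub_dist_le a _ _).trans (M.dist_param_le e hs ht)

/-- Along an edge segment avoiding `a`, the distance to `a` increases at unit speed up to a
peak, and then decreases at unit speed. -/
theorem exists_peak {a : G} {e : M.E} {s t : ℝ} (hs : s ∈ Icc 0 (M.len e))
    (ht : t ∈ Icc 0 (M.len e)) (hst : s ≤ t) (hne : ∀ u ∈ Icc s t, M.param e u ≠ a) :
    ∃ u ∈ Icc s t, dist a (M.param e u) = dist a (M.param e s) + (u - s) ∧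
      dist a (M.param e u) = dist a (M.param e t) + (t - u) := by
  have hst' := abs_le.1 (abs_dist_param_sub_le a e hs ht)
  rw [abs_of_nonpos (by linarith : s - t ≤ 0)] at hst'
  set u := (s + t + dist a (M.param e t) - dist a (M.param e s)) / 2 with hu
  have hsu : s ≤ u := by linarith
  have hut : u ≤ t := by linarith
  have humem : u ∈ Icc 0 (M.len e) := ⟨hs.1.trans hsu, hut.trans ht.2⟩
  have h1 := abs_le.1 (abs_dist_param_sub_le a e humem hs)
  rw [abs_of_nonneg (by linarith : 0 ≤ u - s)] at h1
  have h2 : dist a (M.param e s) + (u - s) ≤ dist a (M.param e u) := by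
    refine le_of_forall_gt_imp_ge_of_dense fun C hC => ?_
    rw [dist_comm] at hC
    rcases exit_of_dist_lt hs.1 hsu hut ht.2 hC with ⟨t', ht', h, -⟩ | h | h
    · exact absurd h.symm (hne t' ht')
    · rw [dist_comm _ a] at h; linarith
    · rw [dist_comm _ a] at h; linarith
  exact ⟨u, ⟨hsu, hut⟩, by linarith, by linarith⟩

variable (M) in
/-- The parametrization of an oriented edge. -/
def opar (o : M.E × Bool) (τ : ℝ) : G := M.param o.1 (if o.2 then τ else M.len o.1 - τ)

theorem dist_opar_le (o : M.E × Bool) {s t : ℝ} (hs : s ∈ Icc 0 (M.len o.1))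
    (ht : t ∈ Icc 0 (M.len o.1)) : dist (M.opar o s) (M.opar o t) ≤ |s - t| := by
  obtain ⟨e, b⟩ := o
  cases b
  · have := M.dist_param_le e (s := M.len e - s) (t := M.len e - t)
      ⟨sub_nonneg.2 hs.2, sub_le_self _ hs.1⟩ ⟨sub_nonneg.2 ht.2, sub_le_self _ ht.1⟩
    rw [sub_sub_sub_cancel_left, abs_sub_comm] at this
    simpa [opar] using this
  · simpa [opar] using M.dist_param_le e hs ht

theorem abs_dist_opar_sub_le (a : G) (o : M.E × Bool) {s t : ℝ} (hs : s ∈ Icc 0 (M.len o.1))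
    (ht : t ∈ Icc 0 (M.len o.1)) : |dist a (M.opar o s) - dist a (M.opar o t)| ≤ |s - t| :=
  (abs_dist_sub_dist_le a _ _).trans (dist_opar_le o hs ht)

theorem eq_of_opar_eq_param {o : M.E × Bool} {e : M.E} {τ t : ℝ} (hτ : τ ∈ Ioo 0 (M.len o.1))
    (ht : t ∈ Icc 0 (M.len e)) (h : M.opar o τ = M.param e t) :
    e = o.1 ∧ t = if o.2 then τ else M.len o.1 - τ := by
  obtain ⟨e', b⟩ := o
  cases b
  · exact eq_of_param_eq_interior (M := M) (s := M.len e' - τ)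
      ⟨sub_pos.2 hτ.2, sub_lt_self _ hτ.1⟩ ht (by simpa [opar] using h)
  · exact eq_of_param_eq_interior (M := M) hτ ht (by simpa [opar] using h)

variable (M) in
/-- `v` does not lie on an open edge. -/
def NotInterior (v : G) : Prop := ∀ e, ∀ t ∈ Ioo 0 (M.len e), M.param e t ≠ v

theorem EdgeChain.first_edge {v q : G} (hv : M.NotInterior v) {L : ℝ}
    (h : M.EdgeChain v q L) : q = v ∨ ∃ o : M.E × Bool, M.opar o 0 = v ∧
      ((∃ τ ∈ Ioo 0 (M.len o.1), q = M.opar o τ ∧ τ ≤ L) ∨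
        M.len o.1 + dist (M.opar o (M.len o.1)) q ≤ L) := by
  have aux : ∀ (o : M.E × Bool) (q' : G) (τ L' : ℝ), M.opar o 0 = v →
      τ ∈ Icc 0 (M.len o.1) → q' = M.opar o τ → τ ≤ L' → q' = v ∨ ∃ o : M.E × Bool,
      M.opar o 0 = v ∧ ((∃ τ ∈ Ioo 0 (M.len o.1), q' = M.opar o τ ∧ τ ≤ L') ∨
        M.len o.1 + dist (M.opar o (M.len o.1)) q' ≤ L') := by
    intro o q' τ L' ho hτ hq hL
    rcases eq_or_lt_of_le hτ.1 with rfl | h0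
    · exact Or.inl (hq.trans ho)
    rcases eq_or_lt_of_le hτ.2 with rfl | h1
    · exact Or.inr ⟨o, ho, Or.inr (by rw [hq, dist_self]; linarith)⟩
    · exact Or.inr ⟨o, ho, Or.inl ⟨τ, ⟨h0, h1⟩, hq, hL⟩⟩
  induction h with
  | refl => exact Or.inl rfl
  | @step q q' L h e s t hs ht hq hq' ih =>
    have hL := h.nonneg
    have hd : dist q q' ≤ |s - t| := hq ▸ hq' ▸ M.dist_param_le e hs ht
    rcases ih with rfl | ⟨o, ho, ⟨τ, hτ, hqo, hτL⟩ | ih⟩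
    · rcases eq_or_lt_of_le hs.1 with rfl | h0
      · refine aux (e, true) q' t _ (by simp [opar, hq]) ht (by simp [opar, hq']) ?_
        rw [zero_sub, abs_neg, abs_of_nonneg ht.1]; linarith
      rcases eq_or_lt_of_le hs.2 with rfl | h1
      · refine aux (e, false) q' (M.len e - t) _ (by simp [opar, hq])
          ⟨sub_nonneg.2 ht.2, sub_le_self _ ht.1⟩ (by simp [opar, hq']) ?_
        rw [abs_of_nonneg (sub_nonneg.2 ht.2)]; linarith
      · exact absurd hq.symm (hv e s ⟨h0, h1⟩)
    · obtain ⟨rfl, hst⟩ := eq_of_opar_eq_param hτ hs (hqo.symm.trans hq)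
      obtain ⟨e, b⟩ := o
      cases b
      · simp only [Bool.false_eq_true, if_false] at hst
        refine aux (e, false) q' (M.len e - t) _ ho
          ⟨sub_nonneg.2 ht.2, sub_le_self _ ht.1⟩ (by simp [opar, hq']) ?_
        have := le_abs_self (s - t)
        linarith
      · simp only [if_true] at hst
        refine aux (e, true) q' t _ ho ht (by simp [opar, hq']) ?_
        have := neg_abs_le (s - t)
        linarith
    · exact Or.inr ⟨o, ho, Or.inr (by linarith [dist_triangle (M.opar o (M.len o.1)) q q'])⟩

/-- From a point not lying on an open edge there is an edge along which the distance to `a`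
decreases at unit speed. -/
theorem exists_descending_edge {a v : G} (hv : M.NotInterior v) (ha : 0 < dist a v) :
    ∃ o : M.E × Bool, M.opar o 0 = v ∧ ∀ τ ∈ Icc 0 (min (M.len o.1) (dist a v)),
      dist a (M.opar o τ) = dist a v - τ := by
  have := M.fintypeE
  by_contra! hcon
  have hcon' : ∀ o : M.E × Bool, ∃ τ, M.opar o 0 = v →
      τ ∈ Icc 0 (min (M.len o.1) (dist a v)) ∧ dist a v < dist a (M.opar o τ) + τ := by
    intro o
    by_cases ho : M.opar o 0 = v
    · obtain ⟨τ, hτ, hne⟩ := hcon o ho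
      refine ⟨τ, fun _ => ⟨hτ, ?_⟩⟩
      have h := abs_le.1 (abs_dist_opar_sub_le a o (s := 0) (t := τ)
        ⟨le_rfl, (M.len_pos _).le⟩ ⟨hτ.1, hτ.2.trans (min_le_left _ _)⟩)
      rw [zero_sub, abs_neg, abs_of_nonneg hτ.1, ho] at h
      exact lt_of_le_of_ne (by linarith) fun h => hne (by linarith)
    · exact ⟨0, fun h => absurd h ho⟩
  choose τ hτ using hcon'
  have hev : ∀ᶠ C in 𝓝[>] (dist a v), ∀ o, M.opar o 0 = v →
      C < dist a (M.opar o (τ o)) + τ o := by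
    refine eventually_all.2 fun o => ?_
    by_cases ho : M.opar o 0 = v
    · filter_upwards [Ioo_mem_nhdsGT (hτ o ho).2] with C hC _ using hC.2
    · exact Eventually.of_forall fun _ h => absurd h ho
  obtain ⟨C, hC, hC0⟩ := (hev.and self_mem_nhdsWithin).exists
  replace hC0 : dist v a < C := by rwa [dist_comm]
  obtain ⟨L, hL, hc⟩ := exists_edgeChain (M := M) hC0
  have hne : a ≠ v := dist_pos.1 ha
  obtain ⟨o, ho, ⟨σ, hσ, hao, hσL⟩ | h⟩ := (hc.first_edge hv).resolve_left hne
  · have h1 := hC o ho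
    have h2 := (hτ o ho).1
    have hσ' : σ ∈ Icc 0 (M.len o.1) := ⟨hσ.1.le, hσ.2.le⟩
    have hτ' : τ o ∈ Icc 0 (M.len o.1) := ⟨h2.1, h2.2.trans (min_le_left _ _)⟩
    have h3 := dist_opar_le o (s := σ) (t := 0) hσ' ⟨le_rfl, (M.len_pos _).le⟩
    rw [ho, ← hao, sub_zero, abs_of_pos hσ.1] at h3
    have h4 := dist_opar_le o hσ' hτ'
    have h5 := h2.2.trans (min_le_right _ _)
    rw [← hao, abs_of_nonneg (by linarith)] at h4
    linarith
  · have h1 := hC o ho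
    have h2 := (hτ o ho).1
    have h3 := h2.2.trans (min_le_left _ _)
    have h4 := dist_opar_le o (s := τ o) (t := M.len o.1) ⟨h2.1, h3⟩
      ⟨(M.len_pos _).le, le_rfl⟩
    rw [abs_of_nonpos (by linarith)] at h4
    have h5 := dist_triangle (M.opar o (τ o)) (M.opar o (M.len o.1)) a
    rw [dist_comm _ a] at h5
    linarith

variable (M) in
theorem eventually_mem_common_edge (p : G) : ∀ᶠ p' in 𝓝 p, ∃ e, ∃ s ∈ Icc 0 (M.len e),
    ∃ t ∈ Icc 0 (M.len e), p = M.param e s ∧ p' = M.param e t := by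
  have := M.fintypeE
  have h : ∀ᶠ p' in 𝓝 p, ∀ e, p' ∈ M.param e '' Icc 0 (M.len e) →
      p ∈ M.param e '' Icc 0 (M.len e) := by
    refine eventually_all.2 fun e => ?_
    have hcl : IsClosed (M.param e '' Icc 0 (M.len e)) :=
      (isCompact_Icc.image_of_continuousOn (M.param_lipschitz e).continuousOn).isClosed
    by_cases hp : p ∈ M.param e '' Icc 0 (M.len e)
    · exact Eventually.of_forall fun _ _ => hp
    · filter_upwards [hcl.isOpen_compl.mem_nhds hp] with p' hp' h using absurd h hp'
  filter_upwards [h] with p' hp'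
  obtain ⟨e, t, ht, rfl⟩ := M.cover p'
  obtain ⟨s, hs, hps⟩ := hp' e ⟨t, ht, rfl⟩
  exact ⟨e, s, hs, t, ht, hps.symm, rfl⟩

end MetricGraphStruct

namespace IsGeodesicSpace

variable {X : Type*} [MetricSpace X]

theorem exists_continuous_geodesic (hX : IsGeodesicSpace X) (x y : X) :
    ∃ γ : ℝ → X, Continuous γ ∧ γ 0 = x ∧ γ (dist x y) = y ∧
      ∀ s ∈ Icc 0 (dist x y), ∀ t ∈ Icc 0 (dist x y), dist (γ s) (γ t) = |s - t| := by
  obtain ⟨γ, h0, h1, h⟩ := hX x y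
  have hD : (0 : ℝ) ≤ dist x y := dist_nonneg
  have hcont : ContinuousOn γ (Icc 0 (dist x y)) :=
    LipschitzOnWith.continuousOn (K := 1) <| LipschitzOnWith.of_dist_le_mul fun s hs t ht => by
      simp [h s hs t ht, Real.dist_eq]
  refine ⟨fun t => γ (projIcc 0 (dist x y) hD t), ?_, ?_, ?_, ?_⟩
  · exact (continuousOn_iff_continuous_domRestrict.1 hcont).comp continuous_projIcc
  · simp [projIcc_left, h0]
  · simp [projIcc_right, h1]
  · intro s hs t ht
    simp only [projIcc_of_mem hD hs, projIcc_of_mem hD ht]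
    exact h s hs t ht

end IsGeodesicSpace

namespace ReebGraphOf

open Filter Topology

variable {X : Type*} [MetricSpace X] {r : X} {G : Type*} [MetricSpace G] (R : ReebGraphOf X r G)

theorem dStar_param_sub (e : R.graph.E) {s t : ℝ} (hs : s ∈ Icc 0 (R.graph.len e))
    (ht : t ∈ Icc 0 (R.graph.len e)) :
    R.dStar (R.graph.param e s) - R.dStar (R.graph.param e t) = s - t := by
  rw [R.dStar_param e s hs, R.dStar_param e t ht]; ring

theorem param_injOn (e : R.graph.E) : InjOn (R.graph.param e) (Icc 0 (R.graph.len e)) := by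
  intro s hs t ht h
  have := R.dStar_param_sub e hs ht
  rw [h] at this
  linarith

theorem dStar_nonneg (p : G) : 0 ≤ R.dStar p := by
  obtain ⟨x, rfl⟩ := R.surj p
  rw [R.dStar_π]; exact dist_nonneg

theorem abs_dStar_sub_le (p q : G) : |R.dStar p - R.dStar q| ≤ dist p q :=
  R.graph.dist_maximal (fun a b => |R.dStar a - R.dStar b|) (by simp)
    (fun _ _ => abs_sub_comm _ _) (fun _ _ _ => abs_sub_le _ _ _)
    (fun e s hs t ht => (congrArg abs (R.dStar_param_sub e hs ht)).le) p q

theorem eventually_dist_le_abs_dStar_sub (p : G) :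
    ∀ᶠ p' in 𝓝 p, dist p p' ≤ |R.dStar p - R.dStar p'| := by
  filter_upwards [R.graph.eventually_mem_common_edge p]
  rintro p' ⟨e, s, hs, t, ht, rfl, rfl⟩
  rw [R.dStar_param_sub e hs ht]
  exact R.graph.dist_param_le e hs ht

theorem dist_π_le (hX : IsGeodesicSpace X) (x y : X) : dist (R.π x) (R.π y) ≤ dist x y := by
  obtain ⟨γ, hγ, h0, h1, h⟩ := hX.exists_continuous_geodesic x y
  have hg : Continuous fun t => R.π (γ t) := R.continuous_π.comp hγ
  have hsub : Icc 0 (dist x y) ⊆ {t | dist (R.π x) (R.π (γ t)) ≤ t} := by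
    refine IsClosed.Icc_subset_of_forall_mem_nhdsWithin ?_ ?_ ?_
    · exact (isClosed_le (continuous_const.dist hg) continuous_id).inter isClosed_Icc
    · simp [h0]
    · rintro t ⟨ht, ht'⟩
      have hev := hg.continuousAt (x := t) (R.eventually_dist_le_abs_dStar_sub (R.π (γ t)))
      filter_upwards [nhdsWithin_le_nhds hev, Ioo_mem_nhdsGT ht'.2] with u hu hu'
      change dist (R.π (γ t)) (R.π (γ u)) ≤ _ at hu
      change dist (R.π x) (R.π (γ t)) ≤ t at ht
      rw [R.dStar_π, R.dStar_π] at hu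
      have h2 := abs_dist_sub_dist_le r (γ t) (γ u)
      rw [h t ⟨ht'.1, ht'.2.le⟩ u ⟨ht'.1.trans hu'.1.le, hu'.2.le⟩,
        abs_of_neg (by linarith [hu'.1] : t - u < 0)] at h2
      linarith [dist_triangle (R.π x) (R.π (γ t)) (R.π (γ u))]
  simpa [h1] using hsub ⟨dist_nonneg, le_rfl⟩

/-- Below a point of an open edge, the geodesic to the root follows that edge. -/
theorem exists_descending_lift (hX : IsGeodesicSpace X) {e : R.graph.E} {s t : ℝ}
    (hs : s ∈ Ioo 0 (R.graph.len e)) (ht : t ∈ Icc 0 s) {y : X} (hy : R.π y = R.graph.param e s) :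
    ∃ y', R.π y' = R.graph.param e t ∧ dist y y' = s - t := by
  obtain ⟨γ, hγ, h0, h1, h⟩ := hX.exists_continuous_geodesic y r
  have hs' : s ∈ Icc 0 (R.graph.len e) := ⟨hs.1.le, hs.2.le⟩
  have hD : dist y r = R.dStar (R.graph.param e 0) + s := by
    rw [← R.dStar_param e s hs', ← hy, R.dStar_π, dist_comm]
  have hsD : s ≤ dist y r := by linarith [R.dStar_nonneg (R.graph.param e 0)]
  have hlev : ∀ u ∈ Icc 0 (dist y r), R.dStar (R.π (γ u)) = dist y r - u := by
    intro u hu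
    have := h u hu (dist y r) ⟨dist_nonneg, le_rfl⟩
    rw [h1, abs_of_nonpos (by linarith [hu.2])] at this
    rw [R.dStar_π, dist_comm, this]; ring
  have hg : Continuous fun t => R.π (γ t) := R.continuous_π.comp hγ
  have hsub : Icc 0 (s - t) ⊆ {u | R.π (γ u) = R.graph.param e (s - u)} := by
    refine IsClosed.Icc_subset_of_forall_mem_nhdsWithin ?_ ?_ ?_
    · have hc : ContinuousOn (fun u => R.graph.param e (s - u)) (Icc 0 (s - t)) :=
        (R.graph.param_lipschitz e).continuousOn.comp (by fun_prop) fun u hu =>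
          ⟨by linarith [hu.2, ht.1], by linarith [hu.1, hs.2]⟩
      have := (hg.continuousOn.prodMk hc).preimage_isClosed_of_isClosed isClosed_Icc
        (isClosed_diagonal (X := G))
      rw [inter_comm]
      exact this
    · simp [h0, hy]
    · rintro u ⟨hu, hu'⟩
      have hsu : s - u ∈ Ioo 0 (R.graph.len e) :=
        ⟨by linarith [hu'.2, ht.1], by linarith [hu'.1, hs.2]⟩
      have hev := hg.continuousAt (x := u) (R.graph.eventually_mem_common_edge (R.π (γ u)))
      filter_upwards [nhdsWithin_le_nhds hev, Ioo_mem_nhdsGT hu'.2] with v hv hv'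
      obtain ⟨e', a, ha, b, hb, hab, hvb⟩ := hv
      obtain ⟨rfl, rfl⟩ := MetricGraphStruct.eq_of_param_eq_interior hsu ha
        ((show R.π (γ u) = _ from hu).symm.trans hab)
      have h3 := R.dStar_param e' b hb
      have hvD : v ∈ Icc 0 (dist y r) :=
        ⟨hu'.1.trans hv'.1.le, by linarith [hv'.2, ht.1]⟩
      rw [← hvb, hlev v hvD] at h3
      have : b = s - v := by linarith
      exact hvb.trans (by rw [this])
  have hmem : s - t ∈ Icc 0 (s - t) := ⟨by linarith [ht.2], le_rfl⟩
  refine ⟨γ (s - t), by simpa using hsub hmem, ?_⟩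
  have := h 0 ⟨le_rfl, dist_nonneg⟩ (s - t) ⟨hmem.1, by linarith [ht.1]⟩
  rw [h0, zero_sub, abs_neg, abs_of_nonneg hmem.1] at this
  exact this

theorem exists_edge_lift [CompactSpace X] (hX : IsGeodesicSpace X) {e : R.graph.E} {s t : ℝ}
    (ht : 0 ≤ t) (hts : t ≤ s) (hs : s ≤ R.graph.len e) :
    ∃ y y', R.π y = R.graph.param e s ∧ R.π y' = R.graph.param e t ∧ dist y y' ≤ s - t := by
  rcases eq_or_lt_of_le hts with rfl | hlt
  · obtain ⟨y, hy⟩ := R.surj (R.graph.param e t)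
    exact ⟨y, y, hy, hy, by simp⟩
  have hpc : Continuous fun σ : Icc t s => R.graph.param e σ :=
    continuousOn_iff_continuous_domRestrict.1 <|
      (R.graph.param_lipschitz e).continuousOn.mono (Icc_subset_Icc ht hs)
  set K : Set (X × X × Icc t s) := {a | R.π a.1 = R.graph.param e a.2.2 ∧
    R.π a.2.1 = R.graph.param e t ∧ dist a.1 a.2.1 ≤ a.2.2 - t} with hK
  have hπ := R.continuous_π
  have hpc' : Continuous fun a : X × X × Icc t s => R.graph.param e a.2.2 :=
    hpc.comp (continuous_snd.comp continuous_snd)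
  have hKc : IsClosed K :=
    (isClosed_eq (hπ.comp continuous_fst) hpc').inter
      ((isClosed_eq (hπ.comp (continuous_fst.comp continuous_snd)) continuous_const).inter
        (isClosed_le (f := fun a : X × X × Icc t s => dist a.1 a.2.1)
          (g := fun a => (a.2.2 : ℝ) - t) (by fun_prop) (by fun_prop)))
  have himg : IsClosed ((fun a : X × X × Icc t s => (a.2.2 : ℝ)) '' K) :=
    (hKc.isCompact.image (by fun_prop)).isClosed
  have hsub : Ioo t s ⊆ (fun a : X × X × Icc t s => (a.2.2 : ℝ)) '' K := by
    intro σ hσ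
    obtain ⟨y, hy⟩ := R.surj (R.graph.param e σ)
    obtain ⟨y', hy', hd⟩ := R.exists_descending_lift hX (t := t)
      ⟨by linarith [hσ.1], by linarith [hσ.2]⟩ ⟨ht, hσ.1.le⟩ hy
    exact ⟨(y, y', ⟨σ, hσ.1.le, hσ.2.le⟩), ⟨hy, hy', hd.le⟩, rfl⟩
  have hcl := himg.closure_subset_iff.2 hsub
  rw [closure_Ioo hlt.ne] at hcl
  obtain ⟨⟨y, y', σ⟩, ⟨h1, h2, h3⟩, hσ⟩ := hcl ⟨hts, le_rfl⟩
  change (σ : ℝ) = s at hσ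
  exact ⟨y, y', by rw [← hσ]; exact h1, h2, by rw [← hσ]; exact h3⟩

/-- One step of a discrete path of mesh `η` in `X`, recorded together with a clock which runs at
least as fast as the level `dist r ·` varies. -/
def LevelStep (r : X) (η : ℝ) (a b : X × ℝ) : Prop :=
  dist a.1 b.1 < η ∧ |dist r b.1 - dist r a.1| ≤ b.2 - a.2

theorem stepChain_of_reebRel {η : ℝ} (hη : 0 < η) {x y : X} (h : reebRel r x y) :
    Relation.ReflTransGen (fun a b : X => dist a b < η ∧ dist r b = dist r a) x y := by
  obtain ⟨-, γ, hγ⟩ := h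
  have hlev : ∀ s t, dist r (γ s) = dist r (γ t) := fun s t => (hγ s).trans (hγ t).symm
  have key := isPreconnected_univ.induction₂' (α := unitInterval)
    (fun s t => Relation.ReflTransGen (fun a b : X => dist a b < η ∧ dist r b = dist r a)
      (γ s) (γ t))
    (fun s _ => by
      rw [nhdsWithin_univ]
      filter_upwards [γ.continuous.continuousAt (x := s) (ball_mem_nhds _ hη)] with t ht
      rw [mem_preimage, mem_ball] at ht
      exact ⟨.single ⟨by rwa [dist_comm] at ht, hlev t s⟩, .single ⟨ht, hlev s t⟩⟩)
    (fun _ _ _ _ _ _ => .trans) (mem_univ 0) (mem_univ 1)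
  simpa using key

theorem levelChain_of_reebRel {η : ℝ} (hη : 0 < η) {x y : X} (h : reebRel r x y) (L : ℝ) :
    Relation.ReflTransGen (LevelStep r η) (x, L) (y, L) :=
  (stepChain_of_reebRel hη h).lift (fun z => (z, L)) fun a b hab =>
    ⟨hab.1, by simp [hab.2]⟩

theorem levelChain_of_dist (hX : IsGeodesicSpace X) (r : X) {η : ℝ} (hη : 0 < η) (x y : X)
    (L : ℝ) : Relation.ReflTransGen (LevelStep r η) (x, L) (y, L + dist x y) := by
  obtain ⟨γ, -, h0, h1, h⟩ := hX.exists_continuous_geodesic x y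
  obtain ⟨n, hn⟩ := exists_nat_gt (dist x y / η)
  have hn0 : (0 : ℝ) < n := (div_nonneg dist_nonneg hη.le).trans_lt hn
  have hlt : dist x y / n < η := by
    rw [div_lt_iff₀ hη] at hn; rw [div_lt_iff₀ hn0]; linarith
  have hmem : ∀ i : ℕ, i ≤ n → i * (dist x y / n) ∈ Icc 0 (dist x y) := by
    intro i hi
    refine ⟨by positivity, ?_⟩
    have : (i : ℝ) ≤ n := by exact_mod_cast hi
    calc (i : ℝ) * (dist x y / n) ≤ n * (dist x y / n) := by gcongr
      _ = dist x y := by field_simp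
  have key : ∀ i : ℕ, i ≤ n → Relation.ReflTransGen (LevelStep r η) (x, L)
      (γ (i * (dist x y / n)), L + i * (dist x y / n)) := by
    intro i
    induction i with
    | zero => intro _; simp only [Nat.cast_zero, zero_mul, h0, add_zero]; exact .refl
    | succ i ih =>
      intro hi
      refine (ih (by lia)).tail ?_
      have hd := h _ (hmem i (by lia)) _ (hmem (i + 1) hi)
      have hstep : ((i + 1 : ℕ) : ℝ) * (dist x y / n) = i * (dist x y / n) + dist x y / n := by
        push_cast; ring
      rw [hstep] at hd ⊢
      rw [sub_add_cancel_left, abs_neg, abs_of_nonneg (by positivity)] at hd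
      refine ⟨hd.trans_lt hlt, ?_⟩
      have := abs_dist_sub_dist_le r (γ (i * (dist x y / n) + dist x y / n))
        (γ (i * (dist x y / n)))
      rw [dist_comm (γ _) (γ _), hd] at this
      simp only
      linarith
  have := key n le_rfl
  rwa [show (n : ℝ) * (dist x y / n) = dist x y by field_simp, h1] at this

theorem levelChain_of_edgeChain [CompactSpace X] (hX : IsGeodesicSpace X) {η : ℝ} (hη : 0 < η)
    {x : X} {q : G} {L : ℝ} (h : R.graph.EdgeChain (R.π x) q L) :
    ∀ y, R.π y = q → Relation.ReflTransGen (LevelStep r η) (x, 0) (y, L) := by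
  induction h with
  | refl => intro y hy; exact levelChain_of_reebRel hη ((R.eq_iff _ _).1 hy.symm) 0
  | @step q q' L h e s t hs ht hq hq' ih =>
    intro y hy
    obtain ⟨z, z', hz, hz', hd⟩ : ∃ z z', R.π z = q ∧ R.π z' = q' ∧ dist z z' ≤ |s - t| := by
      rcases le_total t s with hts | hts
      · obtain ⟨z, z', h1, h2, h3⟩ := R.exists_edge_lift hX ht.1 hts hs.2
        exact ⟨z, z', h1.trans hq.symm, h2.trans hq'.symm, h3.trans (le_abs_self _)⟩
      · obtain ⟨z, z', h1, h2, h3⟩ := R.exists_edge_lift hX hs.1 hts ht.2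
        refine ⟨z', z, h2.trans hq.symm, h1.trans hq'.symm, ?_⟩
        rw [dist_comm, abs_sub_comm]
        exact h3.trans (le_abs_self _)
    refine (((ih z hz).trans (levelChain_of_dist hX r hη z z' L)).tail
      (c := (z', L + |s - t|)) ⟨by simpa using hη, by simpa using hd⟩).trans ?_
    exact levelChain_of_reebRel hη ((R.eq_iff _ _).1 (hz'.trans hy.symm)) _

theorem exists_levelChain [CompactSpace X] (hX : IsGeodesicSpace X) {η : ℝ} (hη : 0 < η)
    {x y : X} {C : ℝ} (hC : dist (R.π x) (R.π y) < C) :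
    ∃ L < C, Relation.ReflTransGen (LevelStep r η) (x, 0) (y, L) := by
  obtain ⟨L, hL, h⟩ := MetricGraphStruct.exists_edgeChain (M := R.graph) hC
  exact ⟨L, hL, R.levelChain_of_edgeChain hX hη h y rfl⟩

theorem exists_incoming_edge (hX : IsGeodesicSpace X) {p : G} (hp : 0 < R.dStar p) :
    ∃ e, ∃ t ∈ Ioc 0 (R.graph.len e), p = R.graph.param e t := by
  obtain ⟨y, rfl⟩ := R.surj p
  rw [R.dStar_π, dist_comm] at hp
  obtain ⟨γ, hγ, h0, h1, h⟩ := hX.exists_continuous_geodesic y r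
  have hg : Continuous fun t => R.π (γ t) := R.continuous_π.comp hγ
  have hev : ∀ᶠ u in 𝓝 (0 : ℝ), _ :=
    hg.continuousAt (x := 0) (R.graph.eventually_mem_common_edge (R.π (γ 0)))
  rw [h0] at hev
  obtain ⟨u, ⟨e, s, hs, t, ht, hys, hut⟩, hu⟩ :=
    ((hev.filter_mono nhdsWithin_le_nhds).and (Ioo_mem_nhdsGT hp)).exists
  refine ⟨e, s, ⟨?_, hs.2⟩, hys⟩
  have h2 := R.dStar_param_sub e hs ht
  rw [← hys, ← hut, R.dStar_π, R.dStar_π] at h2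
  have h3 := h u ⟨hu.1.le, hu.2.le⟩ (dist y r) ⟨dist_nonneg, le_rfl⟩
  rw [h1, abs_of_neg (by linarith [hu.2])] at h3
  rw [dist_comm r y, dist_comm r, h3] at h2
  linarith [ht.1, hu.1]

theorem exists_π_root_eq_src : ∃ e, R.π r = R.graph.param e 0 := by
  obtain ⟨e, t, ht, h⟩ := R.graph.cover (R.π r)
  have h1 := R.dStar_param e t ht
  rw [h, R.dStar_π, dist_self] at h1
  have : t = 0 := le_antisymm (by linarith [R.dStar_nonneg (R.graph.param e 0)]) ht.1
  exact ⟨e, by rw [← h, this]⟩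

end ReebGraphOf

namespace ReebGraphOf

open Filter Topology

variable {X : Type*} [MetricSpace X] {r : X} {G : Type*} [MetricSpace G] (R : ReebGraphOf X r G)

/-- `Φ` is locally constant, except possibly just below the points of `P`. -/
def IsCutConst (P : Set G) (Φ : G → ℝ) : Prop :=
  ∀ p, ∀ᶠ p' in 𝓝 p, Φ p' = Φ p ∨ (p ∈ P ∧ R.dStar p' < R.dStar p)

variable {R} in
theorem isCutConst_of_edges {P : Set G} {Φ : G → ℝ}
    (h : ∀ e, ∀ s ∈ Icc 0 (R.graph.len e), ∃ κ > 0, ∀ t ∈ Icc 0 (R.graph.len e), |t - s| < κ →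
      Φ (R.graph.param e t) = Φ (R.graph.param e s) ∨ (R.graph.param e s ∈ P ∧ t < s)) :
    R.IsCutConst P Φ := by
  have := R.graph.fintypeE
  intro p
  have hκ : ∀ e, ∃ κ > 0, ∀ s ∈ Icc 0 (R.graph.len e), p = R.graph.param e s →
      ∀ t ∈ Icc 0 (R.graph.len e), |t - s| < κ →
      Φ (R.graph.param e t) = Φ (R.graph.param e s) ∨ (R.graph.param e s ∈ P ∧ t < s) := by
    intro e
    by_cases hp : ∃ s ∈ Icc 0 (R.graph.len e), p = R.graph.param e s
    · obtain ⟨s, hs, rfl⟩ := hp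
      obtain ⟨κ, hκ, hh⟩ := h e s hs
      refine ⟨κ, hκ, fun s' hs' hss' => ?_⟩
      rw [← R.param_injOn e hs hs' hss']
      exact hh
    · exact ⟨1, one_pos, fun s hs hps => absurd ⟨s, hs, hps⟩ hp⟩
  choose κ hκ hκ' using hκ
  have hsmall : ∀ᶠ p' in 𝓝 p, ∀ e, dist p' p < κ e :=
    eventually_all.2 fun e => ball_mem_nhds p (hκ e)
  filter_upwards [R.graph.eventually_mem_common_edge p, hsmall]
  rintro p' ⟨e, s, hs, t, ht, rfl, rfl⟩ hd
  have h1 := R.abs_dStar_sub_le (R.graph.param e t) (R.graph.param e s)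
  have h2 := R.dStar_param_sub e ht hs
  rw [h2] at h1
  rcases hκ' e s hs rfl t ht (h1.trans_lt (hd e)) with h | ⟨hP, hlt⟩
  · exact Or.inl h
  · exact Or.inr ⟨hP, by linarith⟩

/-- If no cut-constant function separates the points `P i`, then these points lie on different
incoming edges. -/
theorem incoming_edge_injective {ι : Type*} {P : ι → G}
    {e : ι → R.graph.E} {τ : ι → ℝ} (hτ : ∀ i, τ i ∈ Ioc 0 (R.graph.len (e i)))
    (hP : ∀ i, P i = R.graph.param (e i) (τ i)) (hPinj : Function.Injective P)
    (h : ∀ Φ, R.IsCutConst (range P) Φ → ∀ i j, Φ (P i) = Φ (P j)) :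
    Function.Injective e := by
  classical
  have key : ∀ i j, e i = e j → ¬ τ i < τ j := by
    intro i j hij hlt
    set S := R.graph.param (e i) '' Ico (τ i) (τ j) with hS
    have hτj : τ j ≤ R.graph.len (e i) := hij ▸ (hτ j).2
    have hmem : ∀ e', ∀ t ∈ Icc 0 (R.graph.len e'), R.graph.param e' t ∈ S ↔
        e' = e i ∧ t ∈ Ico (τ i) (τ j) := by
      intro e' t ht
      constructor
      · rintro ⟨σ, hσ, hσt⟩
        obtain ⟨rfl, rfl⟩ := MetricGraphStruct.eq_of_param_eq_interior
          ⟨(hτ i).1.trans_le hσ.1, hσ.2.trans_le hτj⟩ ht hσt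
        exact ⟨rfl, hσ⟩
      · rintro ⟨rfl, ht'⟩
        exact ⟨t, ht', rfl⟩
    have hΦ := h (S.indicator 1) (isCutConst_of_edges fun e' s hs => by
      by_cases he : e' = e i
      · subst he
        have hval : ∀ t ∈ Icc 0 (R.graph.len (e i)), S.indicator (1 : G → ℝ)
            (R.graph.param (e i) t) = if τ i ≤ t ∧ t < τ j then 1 else 0 := by
          intro t ht
          rw [indicator_apply, if_congr (hmem (e i) t ht) rfl rfl]
          simp
        have hi : R.graph.param (e i) (τ i) ∈ range P := ⟨i, hP i⟩
        have hj : R.graph.param (e i) (τ j) ∈ range P := ⟨j, (hP j).trans (by rw [hij])⟩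
        rcases lt_trichotomy s (τ i) with h1 | rfl | h1
        · refine ⟨τ i - s, sub_pos.2 h1, fun t ht hts => Or.inl ?_⟩
          rw [hval t ht, hval s hs, if_neg, if_neg]
          · intro h; linarith [h.1]
          · intro h; linarith [h.1, (abs_lt.1 hts).2]
        · refine ⟨τ j - τ i, sub_pos.2 hlt, fun t ht hts => ?_⟩
          rcases lt_or_ge t (τ i) with h2 | h2
          · exact Or.inr ⟨hi, h2⟩
          · left
            rw [hval t ht, hval _ hs, if_pos, if_pos]
            · exact ⟨le_rfl, hlt⟩
            · exact ⟨h2, by linarith [(abs_lt.1 hts).2]⟩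
        rcases lt_trichotomy s (τ j) with h2 | rfl | h2
        · refine ⟨min (s - τ i) (τ j - s), lt_min (sub_pos.2 h1) (sub_pos.2 h2),
            fun t ht hts => Or.inl ?_⟩
          rw [lt_min_iff, abs_lt, abs_lt] at hts
          rw [hval t ht, hval s hs, if_pos, if_pos]
          · exact ⟨h1.le, h2⟩
          · constructor <;> linarith [hts.1.1, hts.2.2]
        · refine ⟨1, one_pos, fun t ht hts => ?_⟩
          rcases lt_or_ge t (τ j) with h3 | h3
          · exact Or.inr ⟨hj, h3⟩
          · left
            rw [hval t ht, hval _ hs, if_neg, if_neg]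
            · intro h; linarith [h.2]
            · intro h; linarith [h.2]
        · refine ⟨s - τ j, sub_pos.2 h2, fun t ht hts => Or.inl ?_⟩
          rw [hval t ht, hval s hs, if_neg, if_neg]
          · intro h; linarith [h.2]
          · intro h; linarith [h.2, (abs_lt.1 hts).1]
      · refine ⟨1, one_pos, fun t ht _ => Or.inl ?_⟩
        rw [indicator_of_notMem, indicator_of_notMem]
        · rw [hmem e' s hs]; exact fun h => he h.1
        · rw [hmem e' t ht]; exact fun h => he h.1) i j
    rw [indicator_of_mem, indicator_of_notMem] at hΦ
    · simp at hΦ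
    · rw [hP j, hmem _ _ ⟨(hτ j).1.le, (hτ j).2⟩]; exact fun h => lt_irrefl _ h.2.2
    · rw [hP i]; exact ⟨τ i, ⟨le_rfl, hlt⟩, rfl⟩
  intro i j hij
  refine hPinj ?_
  rw [hP i, hP j, hij, le_antisymm (not_lt.1 (key j i hij.symm)) (not_lt.1 (key i j hij))]

/-- A function on the vertices which is constant along the edges not containing the cut points,
extended to a cut-constant function. -/
theorem exists_isCutConst_extension {ι : Type*} {P : ι → G} {e : ι → R.graph.E} {τ : ι → ℝ}
    (hτ : ∀ i, τ i ∈ Ioc 0 (R.graph.len (e i))) (hP : ∀ i, P i = R.graph.param (e i) (τ i))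
    (he : Function.Injective e) {φ : G → ℝ}
    (hφ : ∀ e', e' ∉ range e → φ (R.graph.src e') = φ (R.graph.tgt e')) :
    ∃ Φ : G → ℝ, R.IsCutConst (range P) Φ ∧ ∀ i, Φ (P i) = φ (R.graph.tgt (e i)) := by
  classical
  have hrep : ∀ p : G, ∃ a : R.graph.E × ℝ, a.2 ∈ Icc 0 (R.graph.len a.1) ∧
      R.graph.param a.1 a.2 = p := by
    intro p
    obtain ⟨e, t, ht, h⟩ := R.graph.cover p
    exact ⟨(e, t), ht, h⟩
  choose ρ hρ hρ' using hrep
  set F : R.graph.E → ℝ → ℝ := fun e' t =>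
    if ∃ i, e i = e' ∧ t < τ i then φ (R.graph.src e') else φ (R.graph.tgt e') with hF
  have hF0 : ∀ e', F e' 0 = φ (R.graph.src e') := by
    intro e'
    by_cases h : e' ∈ range e
    · obtain ⟨i, rfl⟩ := h
      exact if_pos ⟨i, rfl, (hτ i).1⟩
    · rw [hF]
      simp only
      rw [hφ e' h, ite_self]
  have hF1 : ∀ e', F e' (R.graph.len e') = φ (R.graph.tgt e') := by
    intro e'
    refine if_neg ?_
    rintro ⟨i, rfl, h⟩
    exact h.not_ge (hτ i).2
  set Φ : G → ℝ := fun p => if p ∈ R.graph.vertexSet then φ p else F (ρ p).1 (ρ p).2 with hΦ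
  have hval : ∀ e', ∀ t ∈ Icc 0 (R.graph.len e'), Φ (R.graph.param e' t) = F e' t := by
    intro e' t ht
    rcases eq_or_lt_of_le ht.1 with rfl | h0
    · rw [hF0]; exact if_pos ⟨e', Or.inl rfl⟩
    rcases eq_or_lt_of_le ht.2 with rfl | h1
    · rw [hF1]; exact if_pos ⟨e', Or.inr rfl⟩
    have hnv : R.graph.param e' t ∉ R.graph.vertexSet := by
      rintro ⟨e'', h | h⟩
      · exact (R.graph.endpoint_not_interior e'' e' t ⟨h0, h1⟩).1 h.symm
      · exact (R.graph.endpoint_not_interior e'' e' t ⟨h0, h1⟩).2 h.symm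
    obtain ⟨ha, hb⟩ := MetricGraphStruct.eq_of_param_eq_interior ⟨h0, h1⟩ (hρ _) (hρ' _).symm
    have : Φ (R.graph.param e' t) = F (ρ (R.graph.param e' t)).1 (ρ (R.graph.param e' t)).2 :=
      if_neg hnv
    rw [this, ha, hb]
  have hFi : ∀ i t, F (e i) t =
      if t < τ i then φ (R.graph.src (e i)) else φ (R.graph.tgt (e i)) := by
    intro i t
    refine if_congr ⟨?_, fun h => ⟨i, rfl, h⟩⟩ rfl rfl
    rintro ⟨j, hj, h⟩
    rwa [he hj] at h
  refine ⟨Φ, isCutConst_of_edges fun e' s hs => ?_, fun i => ?_⟩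
  · by_cases h : e' ∈ range e
    · obtain ⟨i, rfl⟩ := h
      rcases lt_trichotomy s (τ i) with h1 | rfl | h1
      · refine ⟨τ i - s, sub_pos.2 h1, fun t ht hts => Or.inl ?_⟩
        rw [hval _ _ ht, hval _ _ hs, hFi, hFi, if_pos h1,
          if_pos (by linarith [(abs_lt.1 hts).2])]
      · refine ⟨1, one_pos, fun t ht hts => ?_⟩
        rcases lt_or_ge t (τ i) with h2 | h2
        · exact Or.inr ⟨⟨i, hP i⟩, h2⟩
        · left
          rw [hval _ _ ht, hval _ _ hs, hFi, hFi, if_neg h2.not_gt, if_neg (lt_irrefl _)]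
      · refine ⟨s - τ i, sub_pos.2 h1, fun t ht hts => Or.inl ?_⟩
        rw [hval _ _ ht, hval _ _ hs, hFi, hFi, if_neg h1.not_gt,
          if_neg (by linarith [(abs_lt.1 hts).1])]
    · refine ⟨1, one_pos, fun t ht _ => Or.inl ?_⟩
      rw [hval _ _ ht, hval _ _ hs, hF]
      simp only
      rw [hφ e' h, ite_self, ite_self]
  · rw [hP i, hval _ _ ⟨(hτ i).1.le, (hτ i).2⟩, hFi, if_neg (lt_irrefl _)]

/-- A function on the vertices which vanishes at the root and at the targets of a given set of
edges, and is constant along the other edges, is zero. -/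
theorem vertex_function_eq_zero (hX : IsGeodesicSpace X) {S : Set R.graph.E} {φ : G → ℝ}
    (hroot : φ (R.π r) = 0) (hS : ∀ e ∈ S, φ (R.graph.tgt e) = 0)
    (hφ : ∀ e ∉ S, φ (R.graph.src e) = φ (R.graph.tgt e)) :
    ∀ v ∈ R.graph.vertexSet, φ v = 0 := by
  by_contra! hcon
  obtain ⟨v₀, hv₀, hne₀⟩ := hcon
  have hfin := R.graph.finite_vertexSet.subset (sep_subset _ fun v => φ v ≠ 0)
  obtain ⟨v, ⟨hv, hne⟩, hmin⟩ := hfin.exists_minimalFor R.dStar _ ⟨v₀, hv₀, hne₀⟩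
  rcases eq_or_lt_of_le (R.dStar_nonneg v) with h0 | h0
  · obtain ⟨y, rfl⟩ := R.surj v
    rw [R.dStar_π, eq_comm, dist_eq_zero] at h0
    exact hne (h0 ▸ hroot)
  · obtain ⟨e, t, ht, rfl⟩ := R.exists_incoming_edge hX h0
    have hte : t = R.graph.len e := by
      by_contra h
      have htI : t ∈ Ioo 0 (R.graph.len e) := ⟨ht.1, lt_of_le_of_ne ht.2 h⟩
      obtain ⟨e', h | h⟩ := hv
      · exact (R.graph.endpoint_not_interior e' e t htI).1 h.symm
      · exact (R.graph.endpoint_not_interior e' e t htI).2 h.symm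
    subst hte
    by_cases he : e ∈ S
    · exact hne (hS e he)
    · have hs := hmin (j := R.graph.src e) ⟨⟨e, Or.inl rfl⟩, by rwa [hφ e he]⟩
      have h2 := R.dStar_param e _ ⟨(R.graph.len_pos e).le, le_rfl⟩
      have h3 := R.graph.len_pos e
      have := hs (by rw [h2]; simp only [MetricGraphStruct.src]; linarith)
      simp only [MetricGraphStruct.src] at this
      linarith

/-- A family of points of the Reeb graph which is not separated by cutting just below all of its
points has at most `β₁ + 1` elements. -/
theorem card_le_betti1_add_one (hX : IsGeodesicSpace X) {ι : Type*} [Finite ι] {P : ι → G}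
    (hpos : ∀ i, 0 < R.dStar (P i)) (hPinj : Function.Injective P)
    (h : ∀ Φ, R.IsCutConst (range P) Φ → ∀ i j, Φ (P i) = Φ (P j)) :
    Nat.card ι ≤ R.graph.betti1 + 1 := by
  classical
  have := R.graph.fintypeE
  rcases isEmpty_or_nonempty ι with hι | ⟨⟨i₀⟩⟩
  · simp
  choose e τ hτ hP using fun i => R.exists_incoming_edge hX (hpos i)
  have he := R.incoming_edge_injective hτ hP hPinj h
  have := R.graph.finite_vertexSet.to_subtype
  have := Fintype.ofFinite R.graph.vertexSet
  have := Fintype.ofFinite ι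
  obtain ⟨e₀, he₀⟩ := R.exists_π_root_eq_src
  let src' : R.graph.E → R.graph.vertexSet := fun e => ⟨R.graph.src e, e, Or.inl rfl⟩
  let tgt' : R.graph.E → R.graph.vertexSet := fun e => ⟨R.graph.tgt e, e, Or.inr rfl⟩
  let T : (R.graph.vertexSet → ℝ) →ₗ[ℝ] ({e' // e' ∉ range e} → ℝ) × ℝ × ℝ :=
    { toFun := fun φ => (fun e' => φ (tgt' e') - φ (src' e'), φ (src' e₀), φ (tgt' (e i₀)))
      map_add' := fun φ ψ => by ext <;> simp; ring
      map_smul' := fun c φ => by ext <;> simp; ring }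
  have hT : Function.Injective T := by
    rw [← LinearMap.ker_eq_bot, LinearMap.ker_eq_bot']
    intro φ hφ
    obtain ⟨h1, h2, h3⟩ : (∀ e' : {e' // e' ∉ range e}, φ (tgt' e') - φ (src' e') = 0) ∧
        φ (src' e₀) = 0 ∧ φ (tgt' (e i₀)) = 0 := by
      simp only [Prod.ext_iff, funext_iff] at hφ
      exact hφ
    set φ' : G → ℝ := fun p => if hp : p ∈ R.graph.vertexSet then φ ⟨p, hp⟩ else 0 with hφ'
    have hval : ∀ v : R.graph.vertexSet, φ' v = φ v := fun v => dif_pos v.2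
    have hconst : ∀ e' ∉ range e, φ' (R.graph.src e') = φ' (R.graph.tgt e') := by
      intro e' he'
      rw [hval (src' e'), hval (tgt' e')]
      exact (sub_eq_zero.1 (h1 ⟨e', he'⟩)).symm
    obtain ⟨Φ, hΦ, hΦP⟩ := R.exists_isCutConst_extension hτ hP he hconst
    have hzero := R.vertex_function_eq_zero hX (S := range e) (φ := φ')
      (by rw [he₀]; exact (hval (src' e₀)).trans h2)
      (by
        rintro _ ⟨i, rfl⟩
        rw [← hΦP, h Φ hΦ i i₀, hΦP]
        exact (hval (tgt' (e i₀))).trans h3) hconst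
    ext v
    rw [← hval]
    exact hzero v v.2
  have hrank := LinearMap.finrank_le_finrank_of_injective hT
  have hcard : Fintype.card {e' // e' ∉ range e} = Fintype.card R.graph.E - Fintype.card ι := by
    rw [Fintype.card_subtype_compl]
    congr 1
    exact (Fintype.card_congr (Equiv.ofInjective e he)).symm
  have hle : Fintype.card ι ≤ Fintype.card R.graph.E := Fintype.card_le_of_injective e he
  simp only [Module.finrank_prod, Module.finrank_pi, Module.finrank_self, hcard] at hrank
  rw [MetricGraphStruct.betti1, Nat.card_eq_fintype_card, Nat.card_eq_fintype_card,
    Nat.card_eq_fintype_card]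
  omega

end ReebGraphOf

/-- A chain of `Mo`-related points can be shortened so that only consecutive points remain
`Mo`-related. -/
theorem Relation.ReflTransGen.exists_reduced_chain {α : Type*} {T Mo : α → α → Prop}
    {p : α → Prop} (hT : ∀ x y z, T x y → T y z → T x z) {a b : α} (ha : p a)
    (h : Relation.ReflTransGen (fun x y => T x y ∧ Mo x y ∧ p y) a b) :
    ∃ (m : ℕ) (N : ℕ → α), N 0 = a ∧ N m = b ∧ (∀ i < m, T (N i) (N (i + 1))) ∧
      (∀ i < m, Mo (N i) (N (i + 1))) ∧ (∀ i ≤ m, p (N i)) ∧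
      ∀ i j, i + 2 ≤ j → j ≤ m → ¬ Mo (N i) (N j) := by
  classical
  induction h using Relation.ReflTransGen.head_induction_on with
  | refl => exact ⟨0, fun _ => b, rfl, rfl, by simp, by simp, fun _ _ => ha, by lia⟩
  | @head a c hac _ ih =>
    obtain ⟨m, N, h0, hm, hTN, hMN, hpN, hN⟩ := ih hac.2.2
    have hex : Mo a (N 0) := h0 ▸ hac.2.1
    set j := Nat.findGreatest (fun j => Mo a (N j)) m with hj
    have hjm : j ≤ m := Nat.findGreatest_le m
    have hMj : Mo a (N j) := Nat.findGreatest_spec (P := fun j => Mo a (N j)) (Nat.zero_le m) hex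
    have hmax : ∀ i, j < i → i ≤ m → ¬ Mo a (N i) := fun i hi him =>
      Nat.findGreatest_is_greatest hi him
    have hTj : ∀ i ≤ m, T a (N i) := by
      intro i
      induction i with
      | zero => intro _; rw [h0]; exact hac.1
      | succ i ih => intro hi; exact hT _ _ _ (ih (by lia)) (hTN i (by lia))
    refine ⟨m - j + 1, fun i => Nat.casesOn i a fun i => N (j + i), rfl, ?_, ?_, ?_, ?_, ?_⟩
    · simp only [Nat.add_sub_cancel' hjm, hm]
    · rintro (_ | i) hi
      · exact hTj j hjm
      · exact hTN (j + i) (by lia)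
    · rintro (_ | i) hi
      · exact hMj
      · exact hMN (j + i) (by lia)
    · rintro (_ | i) hi
      · exact ha
      · exact hpN (j + i) (by lia)
    · rintro (_ | i) (_ | k) hik hk
      · lia
      · exact hmax (j + k) (by lia) (by lia)
      · lia
      · exact hN (j + i) (j + k) (by lia) (by lia)

/-- The total variation of a sequence `h` without plateaus which stays close to a sequence `H` of
controlled variation is controlled by the number of strict local minima of `h`. -/
theorem sum_abs_sub_le_of_close {h H ℓ : ℕ → ℝ} {ε : ℝ} {m : ℕ} (hm : 1 ≤ m)
    (hne : ∀ i < m, h i ≠ h (i + 1)) (hH : ∀ i < m, |H (i + 1) - H i| ≤ ℓ (i + 1) - ℓ i)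
    (hclose : ∀ i ≤ m, |h i - H i| ≤ 3 * ε) (hclose₀ : |h 0 - H 0| ≤ 2 * ε)
    (hclose₁ : |h m - H m| ≤ 2 * ε) :
    ∑ i ∈ Finset.range m, |h i - h (i + 1)| ≤ ℓ m - ℓ 0 + 12 * ε *
      ((Finset.range m).filter fun i => 0 < i ∧ h i < h (i - 1) ∧ h i < h (i + 1)).card +
      10 * ε := by
  set S : ℕ → ℝ := fun i => ∑ k ∈ Finset.range i, |h k - h (k + 1)| with hS
  set n : ℕ → ℕ := fun i =>
    ((Finset.range i).filter fun i => 0 < i ∧ h i < h (i - 1) ∧ h i < h (i + 1)).card with hn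
  have hε : 0 ≤ ε := by linarith [(abs_nonneg _).trans hclose₀]
  have hSs : ∀ i, S (i + 1) = S i + |h i - h (i + 1)| := fun i => Finset.sum_range_succ _ _
  have hns : ∀ i, (n i : ℝ) ≤ n (i + 1) := fun i =>
    Nat.cast_le.2 (Finset.card_le_card (Finset.filter_subset_filter _
      (Finset.range_subset_range.2 (Nat.le_succ i))))
  have hns' : ∀ i, 0 < i → h i < h (i - 1) → h i < h (i + 1) → (n (i + 1) : ℝ) = n i + 1 := by
    intro i h1 h2 h3
    have : n (i + 1) = n i + 1 := by
      simp only [hn, Finset.range_add_one, Finset.filter_insert]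
      rw [if_pos ⟨h1, h2, h3⟩, Finset.card_insert_of_notMem (by simp)]
    rw [this]; push_cast; rfl
  have key : ∀ i, i + 1 ≤ m →
      (h i < h (i + 1) → S (i + 1) ≤
        ℓ (i + 1) - ℓ 0 + 12 * ε * n (i + 1) + 2 * ε + (h (i + 1) - H (i + 1))) ∧
      (h (i + 1) < h i → S (i + 1) ≤
        ℓ (i + 1) - ℓ 0 + 12 * ε * n (i + 1) + 8 * ε + (H (i + 1) - h (i + 1))) := by
    intro i
    induction i with
    | zero =>
      intro hi
      have h1 := abs_le.1 (hH 0 hi)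
      have h2 := abs_le.1 hclose₀
      have h3 : (0 : ℝ) ≤ 12 * ε * n 1 := by positivity
      have h4 : S 1 = |h 0 - h 1| := by simp [hS]
      simp only [zero_add] at h1 ⊢
      constructor
      · intro h5
        rw [h4, abs_of_neg (by linarith)]; linarith
      · intro h5
        rw [h4, abs_of_pos (by linarith)]; linarith
    | succ i ih =>
      intro hi
      obtain ⟨ihu, ihd⟩ := ih (by lia)
      have h1 := abs_le.1 (hH (i + 1) hi)
      have h2 := abs_le.1 (hclose (i + 1) (by lia))
      have h3 := mul_le_mul_of_nonneg_left (hns (i + 1)) hε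
      rw [hSs]
      constructor
      · intro h5
        rw [abs_of_neg (by linarith)]
        rcases lt_or_gt_of_ne (hne i (by lia)) with h6 | h6
        · linarith [ihu h6]
        · rw [hns' (i + 1) (by lia) h6 h5]
          linarith [ihd h6]
      · intro h5
        rw [abs_of_pos (by linarith)]
        rcases lt_or_gt_of_ne (hne i (by lia)) with h6 | h6
        · linarith [ihu h6]
        · linarith [ihd h6]
  obtain ⟨i, rfl⟩ : ∃ i, m = i + 1 := ⟨m - 1, by lia⟩
  obtain ⟨hu, hd⟩ := key i le_rfl
  have h2 := abs_le.1 hclose₁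
  change S (i + 1) ≤ ℓ (i + 1) - ℓ 0 + 12 * ε * n (i + 1) + 10 * ε
  rcases lt_or_gt_of_ne (hne i (by lia)) with h6 | h6
  · linarith [hu h6]
  · linarith [hd h6]

namespace MetricGraphStruct

open Filter Topology

variable {G : Type*} [MetricSpace G] {M : MetricGraphStruct G}

variable (M) in
/-- The change of coordinate between the parametrization of an edge and that of an orientation
of this edge. -/
def coord (o : M.E × Bool) (τ : ℝ) : ℝ := if o.2 then τ else M.len o.1 - τ

theorem opar_eq_param (o : M.E × Bool) (τ : ℝ) : M.opar o τ = M.param o.1 (M.coord o τ) := rfl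

theorem coord_coord (o : M.E × Bool) (τ : ℝ) : M.coord o (M.coord o τ) = τ := by
  unfold coord; split_ifs <;> ring

theorem param_eq_opar (o : M.E × Bool) (t : ℝ) : M.param o.1 t = M.opar o (M.coord o t) := by
  rw [opar_eq_param, coord_coord]

theorem coord_mem_Icc {o : M.E × Bool} {τ : ℝ} (hτ : τ ∈ Icc 0 (M.len o.1)) :
    M.coord o τ ∈ Icc 0 (M.len o.1) := by
  unfold coord
  split_ifs
  · exact hτ
  · exact ⟨sub_nonneg.2 hτ.2, sub_le_self _ hτ.1⟩

theorem abs_coord_sub_coord (o : M.E × Bool) (s t : ℝ) :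
    |M.coord o s - M.coord o t| = |s - t| := by
  unfold coord
  split_ifs
  · rfl
  · rw [sub_sub_sub_cancel_left, abs_sub_comm]

theorem eq_of_opar_eq_opar {o o' : M.E × Bool} {τ τ' : ℝ} (hτ : τ ∈ Ioo 0 (M.len o.1))
    (hτ' : τ' ∈ Icc 0 (M.len o'.1)) (h : M.opar o τ = M.opar o' τ') :
    (o' = o ∧ τ' = τ) ∨ (o' = (o.1, !o.2) ∧ τ' = M.len o.1 - τ) := by
  obtain ⟨he, ht⟩ := eq_of_opar_eq_param hτ (coord_mem_Icc hτ') h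
  obtain ⟨e, b⟩ := o
  obtain ⟨e', b'⟩ := o'
  simp only at he
  subst he
  cases b <;> cases b' <;> simp_all [coord]
  linarith

theorem opar_not (o : M.E × Bool) (τ : ℝ) :
    M.opar (o.1, !o.2) τ = M.opar o (M.len o.1 - τ) := by
  obtain ⟨e, b⟩ := o
  cases b <;> simp [opar]

theorem exit_opar_of_dist_lt {o : M.E × Bool} {α β u : ℝ} (h0 : 0 ≤ α) (hα : α ≤ u) (hβ : u ≤ β)
    (h1 : β ≤ M.len o.1) {q : G} {C : ℝ} (h : dist (M.opar o u) q < C) :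
    (∃ t ∈ Icc α β, q = M.opar o t ∧ |u - t| < C) ∨ u - α + dist (M.opar o α) q < C ∨
      β - u + dist (M.opar o β) q < C := by
  obtain ⟨e, b⟩ := o
  cases b
  · simp only [opar, Bool.false_eq_true, if_false] at h h1 ⊢
    rcases exit_of_dist_lt (α := M.len e - β) (β := M.len e - α) (by linarith) (by linarith)
      (by linarith) (by linarith) h with ⟨t, ht, hq, hut⟩ | h | h
    · refine Or.inl ⟨M.len e - t, ⟨by linarith [ht.2], by linarith [ht.1]⟩, ?_, ?_⟩
      · rw [hq]; congr 1; ring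
      · rw [abs_sub_comm] at hut; convert hut using 2; ring
    · right; right; linarith
    · right; left; linarith
  · exact exit_of_dist_lt h0 hα hβ h1 h

variable (M) in
/-- `p` and `q` bound an edge segment along which the distance to `a` is monotone at unit
speed. -/
def MonoEdge (a p q : G) : Prop :=
  ∃ e, ∃ s ∈ Icc 0 (M.len e), ∃ t ∈ Icc 0 (M.len e), p = M.param e s ∧ q = M.param e t ∧
    |s - t| = |dist a p - dist a q|

theorem MonoEdge.symm {a p q : G} (h : M.MonoEdge a p q) : M.MonoEdge a q p := by
  obtain ⟨e, s, hs, t, ht, hp, hq, hst⟩ := h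
  exact ⟨e, t, ht, s, hs, hq, hp, by rw [abs_sub_comm, hst, abs_sub_comm]⟩

variable (M) in
theorem MonoEdge.refl (a p : G) : M.MonoEdge a p p := by
  obtain ⟨e, t, ht, h⟩ := M.cover p
  exact ⟨e, t, ht, t, ht, h.symm, h.symm, by simp⟩

theorem MonoEdge.dist_le {a p q : G} (h : M.MonoEdge a p q) :
    dist p q ≤ |dist a p - dist a q| := by
  obtain ⟨e, s, hs, t, ht, rfl, rfl, hst⟩ := h
  rw [← hst]
  exact M.dist_param_le e hs ht

theorem MonoEdge.eq_of_dist_eq {a p q : G} (h : M.MonoEdge a p q) (hd : dist a p = dist a q) :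
    p = q := by
  have := h.dist_le
  rw [hd, sub_self, abs_zero] at this
  exact dist_le_zero.1 this

theorem monoEdge_opar {a : G} {o : M.E × Bool} {s t : ℝ} (hs : s ∈ Icc 0 (M.len o.1))
    (ht : t ∈ Icc 0 (M.len o.1)) (h : |s - t| = |dist a (M.opar o s) - dist a (M.opar o t)|) :
    M.MonoEdge a (M.opar o s) (M.opar o t) :=
  ⟨o.1, M.coord o s, coord_mem_Icc hs, M.coord o t, coord_mem_Icc ht, rfl, rfl, by
    rw [abs_coord_sub_coord, h]⟩

/-- If the distance to `a` has a strict local minimum at a point of an open edge, then both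
higher neighbours of this point are on the same side of it. -/
theorem monoEdge_of_local_min {a : G} (e : M.E) {s t₁ t₂ : ℝ} (hs : s ∈ Icc 0 (M.len e))
    (h₁ : t₁ ∈ Icc 0 (M.len e)) (h₂ : t₂ ∈ Icc 0 (M.len e))
    (hd₁ : dist a (M.param e t₁) = dist a (M.param e s) + |t₁ - s|)
    (hd₂ : dist a (M.param e t₂) = dist a (M.param e s) + |t₂ - s|)
    (hne₁ : t₁ ≠ s) (hne₂ : t₂ ≠ s) (hpos : 0 < dist a (M.param e s)) :
    M.MonoEdge a (M.param e t₁) (M.param e t₂) := by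
  wlog hle : t₁ ≤ t₂ generalizing t₁ t₂
  · exact (this h₂ h₁ hd₂ hd₁ hne₂ hne₁ (le_of_not_ge hle)).symm
  rcases lt_or_gt_of_ne hne₁ with h1 | h1 <;> rcases lt_or_gt_of_ne hne₂ with h2 | h2
  · refine ⟨e, t₁, h₁, t₂, h₂, rfl, rfl, ?_⟩
    rw [hd₁, hd₂, abs_of_neg (by linarith : t₁ - s < 0), abs_of_neg (by linarith : t₂ - s < 0),
      abs_sub_comm]
    ring_nf
  · rw [abs_of_neg (by linarith)] at hd₁
    rw [abs_of_pos (by linarith)] at hd₂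
    have hne : ∀ u ∈ Icc t₁ t₂, M.param e u ≠ a := by
      intro u hu hua
      have humem : u ∈ Icc 0 (M.len e) := ⟨h₁.1.trans hu.1, hu.2.trans h₂.2⟩
      have h3 := abs_dist_param_sub_le a e h₁ humem
      have h4 := abs_dist_param_sub_le a e h₂ humem
      rw [abs_of_nonpos (by linarith [hu.1] : t₁ - u ≤ 0)] at h3
      rw [abs_of_nonneg (by linarith [hu.2] : 0 ≤ t₂ - u)] at h4
      rw [hua, dist_self] at h3 h4
      linarith [(abs_le.1 h3).2, (abs_le.1 h4).2]
    obtain ⟨u, hu, h5, h6⟩ := exists_peak h₁ h₂ hle hne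
    have humem : u ∈ Icc 0 (M.len e) := ⟨h₁.1.trans hu.1, hu.2.trans h₂.2⟩
    have h7 := (abs_le.1 (abs_dist_param_sub_le a e humem hs)).2
    rcases le_total s u with hsu | hsu
    · rw [abs_of_nonneg (by linarith)] at h7; linarith
    · rw [abs_of_nonpos (by linarith)] at h7; linarith
  · linarith
  · refine ⟨e, t₁, h₁, t₂, h₂, rfl, rfl, ?_⟩
    rw [hd₁, hd₂, abs_of_pos (by linarith : 0 < t₁ - s), abs_of_pos (by linarith : 0 < t₂ - s)]
    ring_nf

theorem MonoEdge.exists_of_interior {a q : G} {e : M.E} {t : ℝ} (ht : t ∈ Ioo 0 (M.len e))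
    (h : M.MonoEdge a (M.param e t) q) : ∃ s ∈ Icc 0 (M.len e), q = M.param e s ∧
      |s - t| = |dist a q - dist a (M.param e t)| := by
  obtain ⟨e', t', ht', s, hs, hp, rfl, hst⟩ := h
  obtain ⟨rfl, rfl⟩ := eq_of_param_eq_interior ht ht' hp
  exact ⟨s, hs, rfl, by rw [abs_sub_comm, hst, abs_sub_comm]⟩

/-- In a reduced chain, the strict local minima are vertices. -/
theorem notInterior_of_local_min {a p q₁ q₂ : G} (h₁ : M.MonoEdge a p q₁)
    (h₂ : M.MonoEdge a p q₂) (hd₁ : dist a p < dist a q₁) (hd₂ : dist a p < dist a q₂)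
    (hpos : 0 < dist a p) (hnot : ¬ M.MonoEdge a q₁ q₂) : M.NotInterior p := by
  rintro e t ht rfl
  obtain ⟨s₁, hs₁, rfl, hst₁⟩ := h₁.exists_of_interior ht
  obtain ⟨s₂, hs₂, rfl, hst₂⟩ := h₂.exists_of_interior ht
  rw [abs_of_pos (by linarith : 0 < dist a (M.param e s₁) - _)] at hst₁
  rw [abs_of_pos (by linarith : 0 < dist a (M.param e s₂) - _)] at hst₂
  refine hnot (monoEdge_of_local_min e ⟨ht.1.le, ht.2.le⟩ hs₁ hs₂ (by linarith) (by linarith)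
    ?_ ?_ hpos)
  · rintro rfl; exact lt_irrefl _ hd₁
  · rintro rfl; exact lt_irrefl _ hd₂

variable (M) in
/-- The union of the edge segments witnessing `M.MonoEdge a p q`. -/
def monoSegment (a p q : G) : Set G :=
  {w | ∃ e, ∃ s ∈ Icc 0 (M.len e), ∃ t ∈ Icc 0 (M.len e), p = M.param e s ∧ q = M.param e t ∧
    |s - t| = |dist a p - dist a q| ∧ ∃ u ∈ uIcc s t, w = M.param e u}

theorem MonoEdge.isPreconnected_monoSegment {a p q : G} :
    IsPreconnected (M.monoSegment a p q) := by
  refine isPreconnected_of_forall p ?_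
  rintro w ⟨e, s, hs, t, ht, hp, hq, hst, u, hu, hw⟩
  refine ⟨M.param e '' uIcc s t, ?_, ⟨s, left_mem_uIcc, hp.symm⟩, ⟨u, hu, hw.symm⟩, ?_⟩
  · rintro _ ⟨v, hv, rfl⟩
    exact ⟨e, s, hs, t, ht, hp, hq, hst, v, hv, rfl⟩
  · exact isPreconnected_uIcc.image _
      ((M.param_lipschitz e).continuousOn.mono (uIcc_subset_Icc hs ht))

theorem MonoEdge.left_mem {a p q : G} (h : M.MonoEdge a p q) : p ∈ M.monoSegment a p q := by
  obtain ⟨e, s, hs, t, ht, hp, hq, hst⟩ := h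
  exact ⟨e, s, hs, t, ht, hp, hq, hst, s, left_mem_uIcc, hp⟩

theorem MonoEdge.right_mem {a p q : G} (h : M.MonoEdge a p q) : q ∈ M.monoSegment a p q := by
  obtain ⟨e, s, hs, t, ht, hp, hq, hst⟩ := h
  exact ⟨e, s, hs, t, ht, hp, hq, hst, t, right_mem_uIcc, hq⟩

/-- From a point of a monotone segment, the lower endpoint is reached by descending along an
edge. -/
theorem exists_lower_of_mem_monoSegment {a p q w : G} (h : w ∈ M.monoSegment a p q) :
    ∃ z, (z = p ∨ z = q) ∧ ∃ e, ∃ s ∈ Icc 0 (M.len e), ∃ u ∈ Icc 0 (M.len e),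
      z = M.param e s ∧ w = M.param e u ∧ dist a z = dist a w - |s - u| := by
  obtain ⟨e, s, hs, t, ht, rfl, rfl, hst, u, hu, rfl⟩ := h
  have humem : u ∈ Icc 0 (M.len e) := uIcc_subset_Icc hs ht hu
  have h1 := abs_le.1 (abs_dist_param_sub_le a e hs humem)
  have h2 := abs_le.1 (abs_dist_param_sub_le a e ht humem)
  have h3 : |s - t| = |s - u| + |t - u| := by
    rcases mem_uIcc.1 hu with ⟨h, h'⟩ | ⟨h, h'⟩
    · rw [abs_of_nonpos (by linarith), abs_of_nonpos (by linarith : s - u ≤ 0),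
        abs_of_nonneg (by linarith)]; ring
    · rw [abs_of_nonneg (by linarith), abs_of_nonneg (by linarith : 0 ≤ s - u),
        abs_of_nonpos (by linarith)]; ring
  rcases le_total (dist a (M.param e s)) (dist a (M.param e t)) with h | h
  · refine ⟨_, Or.inl rfl, e, s, hs, u, humem, rfl, rfl, ?_⟩
    rw [abs_of_nonpos (by linarith : dist a (M.param e s) - _ ≤ 0)] at hst
    linarith
  · refine ⟨_, Or.inr rfl, e, t, ht, u, humem, rfl, rfl, ?_⟩
    rw [abs_of_nonneg (by linarith : 0 ≤ dist a (M.param e s) - _)] at hst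
    linarith

/-- If a monotone segment meets the interior of a descending edge segment issued from `v`, then
its lower endpoint is below `v` on that edge. -/
theorem exists_monoEdge_lower {a p q v : G} {o : M.E × Bool} {c τ : ℝ} (ho : M.opar o 0 = v)
    (hc : c ≤ M.len o.1) (hdesc : ∀ τ ∈ Icc 0 c, dist a (M.opar o τ) = dist a v - τ)
    (hτ : τ ∈ Ioo 0 c) (h : M.opar o τ ∈ M.monoSegment a p q) :
    ∃ z, (z = p ∨ z = q) ∧ M.MonoEdge a v z ∧ dist a z < dist a v := by
  obtain ⟨z, hz, e, s, hs, u, hu, rfl, hw, hd⟩ := exists_lower_of_mem_monoSegment h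
  refine ⟨_, hz, ?_⟩
  obtain ⟨rfl, hut⟩ := eq_of_opar_eq_param ⟨hτ.1, hτ.2.trans_le hc⟩ hu hw
  have hsu : |s - u| = |M.coord o s - τ| := by
    rw [← abs_coord_sub_coord o s u, hut]
    congr 2
    exact coord_coord o τ
  rw [param_eq_opar o s] at hd ⊢
  rw [hsu, hdesc τ ⟨hτ.1.le, hτ.2.le⟩] at hd
  have hσ := coord_mem_Icc hs
  set σ := M.coord o s with hσdef
  rcases le_total τ σ with hle | hle
  · rw [abs_of_nonneg (by linarith)] at hd
    refine ⟨?_, by linarith [hτ.1]⟩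
    rw [← ho] at hd ⊢
    refine monoEdge_opar ⟨le_rfl, (M.len_pos _).le⟩ hσ ?_
    rw [hd, abs_sub_comm]
    congr 1
    ring
  · rw [abs_of_nonpos (by linarith), hdesc σ ⟨hσ.1, hle.trans hτ.2.le⟩] at hd
    have hστ : σ = τ := by linarith
    rw [hστ]
    have hd' := hdesc τ ⟨hτ.1.le, hτ.2.le⟩
    refine ⟨?_, by linarith [hτ.1]⟩
    rw [← ho] at hd' ⊢
    refine monoEdge_opar ⟨le_rfl, (M.len_pos _).le⟩ ⟨hτ.1.le, hτ.2.le.trans hc⟩ ?_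
    rw [hd', abs_sub_comm]
    congr 1
    ring

end MetricGraphStruct

namespace ReebGraphOf

open Filter Topology

variable {X : Type*} [MetricSpace X] {r : X} {Y : Type*} [MetricSpace Y]

/-- The image of a preconnected set under a coarse map can be joined by paths in a
neighbourhood. -/
theorem joinedIn_near_image (hX : IsGeodesicSpace X) {k : Y → X} {ε η : ℝ} (hη : 0 < η)
    (hk : ∀ y y', dist y y' < η → dist (k y) (k y') < 2 * ε) {B : Set Y} (hB : IsPreconnected B)
    {b b' : Y} (hb : b ∈ B) (hb' : b' ∈ B) :
    JoinedIn {z | ∃ a ∈ B, dist z (k a) < ε} (k b) (k b') := by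
  refine hB.induction₂ (fun b b' => JoinedIn {z | ∃ a ∈ B, dist z (k a) < ε} (k b) (k b'))
    (fun b hb => ?_) (fun _ _ _ _ _ _ => JoinedIn.trans) (fun _ _ _ _ => JoinedIn.symm) hb hb'
  filter_upwards [self_mem_nhdsWithin, nhdsWithin_le_nhds (ball_mem_nhds b hη)] with b' hb' hbb'
  rw [mem_ball, dist_comm] at hbb'
  obtain ⟨γ, hγ, h0, h1, h⟩ := hX.exists_continuous_geodesic (k b) (k b')
  have hd := hk b b' hbb'
  have hpc : IsPathConnected (γ '' Icc 0 (dist (k b) (k b'))) :=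
    ((convex_Icc _ _).isPathConnected ⟨0, le_rfl, dist_nonneg⟩).image hγ
  refine (hpc.joinedIn _ ⟨0, ⟨le_rfl, dist_nonneg⟩, h0⟩ _ ⟨_, ⟨dist_nonneg, le_rfl⟩, h1⟩).mono ?_
  rintro _ ⟨t, ht, rfl⟩
  have h2 := h t ht 0 ⟨le_rfl, dist_nonneg⟩
  have h3 := h t ht _ ⟨dist_nonneg, le_rfl⟩
  rw [h0, sub_zero, abs_of_nonneg ht.1] at h2
  rw [h1, abs_of_nonpos (by linarith [ht.2])] at h3
  rcases lt_or_ge t ε with hlt | hge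
  · exact ⟨b, hb, h2.trans_lt hlt⟩
  · exact ⟨b', hb', by linarith⟩

theorem IsCutConst.eq_of_path {G : Type*} [MetricSpace G] {R : ReebGraphOf X r G} {P : Set G}
    {Φ : G → ℝ} (hΦ : R.IsCutConst P Φ) {q : ℝ → X} (hq : Continuous q) {α β : ℝ} (hαβ : α ≤ β)
    (h : ∀ s ∈ Icc α β, R.π (q s) ∈ P → ∀ t ∈ Icc α β, dist r (q s) ≤ dist r (q t)) :
    Φ (R.π (q α)) = Φ (R.π (q β)) := by
  refine isPreconnected_Icc.induction₂ (s := Icc α β)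
    (fun s t => Φ (R.π (q s)) = Φ (R.π (q t))) (fun s hs => ?_)
    (fun _ _ _ _ _ _ => Eq.trans) (fun _ _ _ _ => Eq.symm) ⟨le_rfl, hαβ⟩ ⟨hαβ, le_rfl⟩
  have hev : ∀ᶠ t in 𝓝 s, _ :=
    (R.continuous_π.comp hq).continuousAt (x := s) (hΦ (R.π (q s)))
  filter_upwards [self_mem_nhdsWithin, nhdsWithin_le_nhds hev] with t ht htΦ
  rcases htΦ with h1 | ⟨h1, h2⟩
  · exact h1.symm
  · simp only [Function.comp_apply, R.dStar_π] at h2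
    exact absurd (h s hs h1 t ht) (not_le.2 h2)

variable {M : MetricGraphStruct Y} {f : X → Y} {k : Y → X} {ε η : ℝ}

section Spine

variable {v : Y} {o : M.E × Bool}

theorem exists_mem_spine_of_near (hfk : ∀ x y, |dist (f x) y - dist x (k y)| < 2 * ε)
    (hff : ∀ x x', |dist (f x) (f x') - dist x x'| < 2 * ε)
    (ho : M.opar o 0 = v) (hlen : 8 * ε < M.len o.1)
    (hdesc : ∀ τ ∈ Icc 0 (8 * ε), dist (f r) (M.opar o τ) = dist (f r) v - τ)
    {z : X} {s : ℝ} (hs : s ∈ Icc 0 (8 * ε)) (hz : dist z (k (M.opar o s)) < ε)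
    (hlev : dist r z = dist (f r) v - 4 * ε) :
    ∃ δ ∈ Ioo (2 * ε) (6 * ε), f z = M.opar o δ := by
  have hε : 0 < ε := dist_nonneg.trans_lt hz
  have h1 := abs_lt.1 (hfk z (M.opar o s))
  have h2 := abs_lt.1 (hff r z)
  have h3 := abs_lt.1 (hfk r (M.opar o s))
  have h4 := abs_le.1 (abs_dist_sub_dist_le r z (k (M.opar o s)))
  rw [hdesc s hs] at h3
  have hd : dist (M.opar o s) (f z) < 3 * ε := by rw [dist_comm]; linarith
  rcases MetricGraphStruct.exit_opar_of_dist_lt le_rfl hs.1 hs.2 hlen.le hd with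
    ⟨δ, hδ, hfz, -⟩ | h | h
  · have h5 := hdesc δ hδ
    rw [← hfz] at h5
    exact ⟨δ, ⟨by linarith, by linarith⟩, hfz⟩
  · have h5 := abs_le.1 (abs_dist_sub_dist_le (f r) (M.opar o 0) (f z))
    rw [ho] at h5 h
    linarith
  · have h5 := abs_le.1 (abs_dist_sub_dist_le (f r) (M.opar o (8 * ε)) (f z))
    rw [hdesc (8 * ε) ⟨by linarith, le_rfl⟩] at h5
    linarith

theorem exists_mem_spine_of_reebRel (hε : 0 < ε) (hη : 0 < η)
    (hf : ∀ x x', dist x x' < η → dist (f x) (f x') < 2 * ε)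
    (hff : ∀ x x', |dist (f x) (f x') - dist x x'| < 2 * ε)
    (hlen : 8 * ε < M.len o.1)
    (hdesc : ∀ τ ∈ Icc 0 (8 * ε), dist (f r) (M.opar o τ) = dist (f r) v - τ)
    {z z' : X} (hlev : dist r z = dist (f r) v - 4 * ε)
    (hz : ∃ δ ∈ Ioo (2 * ε) (6 * ε), f z = M.opar o δ) (h : reebRel r z z') :
    ∃ δ ∈ Ioo (2 * ε) (6 * ε), f z' = M.opar o δ := by
  suffices hs : dist r z' = dist (f r) v - 4 * ε ∧
      ∃ δ ∈ Ioo (2 * ε) (6 * ε), f z' = M.opar o δ from hs.2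
  have hchain := stepChain_of_reebRel hη h
  clear h
  induction hchain with
  | refl => exact ⟨hlev, hz⟩
  | @tail b c _ hbc ih =>
    obtain ⟨hb, δ, hδ, hfb⟩ := ih
    have hc : dist r c = dist (f r) v - 4 * ε := hbc.2.trans hb
    refine ⟨hc, ?_⟩
    have hd := hf b c hbc.1
    rw [hfb] at hd
    have h0 : (0 : ℝ) ≤ dist (M.opar o 0) (f c) := dist_nonneg
    have h1 : (0 : ℝ) ≤ dist (M.opar o (8 * ε)) (f c) := dist_nonneg
    rcases MetricGraphStruct.exit_opar_of_dist_lt le_rfl (by linarith [hδ.1])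
      (by linarith [hδ.2] : δ ≤ 8 * ε) hlen.le hd with ⟨δ', hδ', hfc, -⟩ | h | h
    · have h2 := abs_lt.1 (hff r c)
      have h3 := hdesc δ' hδ'
      rw [← hfc] at h3
      exact ⟨δ', ⟨by linarith, by linarith⟩, hfc⟩
    · linarith [hδ.1]
    · linarith [hδ.2]

theorem near_mem_spine (hfk : ∀ x y, |dist (f x) y - dist x (k y)| < 2 * ε)
    (ho : M.opar o 0 = v) (hlen : 8 * ε < M.len o.1)
    (hdesc : ∀ τ ∈ Icc 0 (8 * ε), dist (f r) (M.opar o τ) = dist (f r) v - τ)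
    {z : X} {a : Y} (hz : dist z (k a) < ε) (hlev : dist r z = dist (f r) v - 4 * ε)
    (hfz : ∃ δ ∈ Ioo (2 * ε) (6 * ε), f z = M.opar o δ) :
    ∃ σ ∈ Ioo 0 (8 * ε), a = M.opar o σ := by
  obtain ⟨δ, hδ, hfz⟩ := hfz
  have hε : 0 < ε := dist_nonneg.trans_lt hz
  have h1 := abs_lt.1 (hfk z a)
  have h3 := abs_lt.1 (hfk r a)
  have h4 := abs_le.1 (abs_dist_sub_dist_le r z (k a))
  have hd : dist (M.opar o δ) a < 3 * ε := by rw [← hfz]; linarith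
  have h5 := abs_le.1 (abs_dist_sub_dist_le (f r) (M.opar o 0) a)
  have h6 := abs_le.1 (abs_dist_sub_dist_le (f r) (M.opar o (8 * ε)) a)
  have h7 : ¬ dist (M.opar o 0) a < ε := by
    intro h
    rw [ho] at h5 h
    linarith
  have h8 : ¬ dist (M.opar o (8 * ε)) a < ε := by
    intro h
    rw [hdesc (8 * ε) ⟨by linarith, le_rfl⟩] at h6
    linarith
  rcases MetricGraphStruct.exit_opar_of_dist_lt le_rfl (by linarith [hδ.1])
      (by linarith [hδ.2] : δ ≤ 8 * ε) hlen.le hd with ⟨σ, hσ, rfl, -⟩ | h | h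
  · rcases eq_or_lt_of_le hσ.1 with rfl | h9
    · rw [dist_self] at h7; exact absurd hε h7
    rcases eq_or_lt_of_le hσ.2 with rfl | h10
    · rw [dist_self] at h8; exact absurd hε h8
    · exact ⟨σ, ⟨h9, h10⟩, rfl⟩
  · exact absurd (by linarith [hδ.1]) h7
  · exact absurd (by linarith [hδ.2]) h8

/-- A path following the spine crosses the middle level of the spine. -/
theorem exists_path_to_level (hX : IsGeodesicSpace X) (hε : 0 < ε) (hη : 0 < η)
    (hk : ∀ y y', dist y y' < η → dist (k y) (k y') < 2 * ε)
    (hfk : ∀ x y, |dist (f x) y - dist x (k y)| < 2 * ε)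
    (ho : M.opar o 0 = v) (hlen : 8 * ε < M.len o.1)
    (hdesc : ∀ τ ∈ Icc 0 (8 * ε), dist (f r) (M.opar o τ) = dist (f r) v - τ) :
    ∃ (q : ℝ → X) (T : ℝ), Continuous q ∧ 0 ≤ T ∧ q 0 = k v ∧
      dist r (q T) = dist (f r) v - 4 * ε ∧
      (∀ t ∈ Ico 0 T, dist (f r) v - 4 * ε < dist r (q t)) ∧
      ∀ t, ∃ s ∈ Icc 0 (8 * ε), dist (q t) (k (M.opar o s)) < ε := by
  have hB : IsPreconnected (M.opar o '' Icc 0 (8 * ε)) := by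
    refine isPreconnected_Icc.image _ (LipschitzOnWith.continuousOn (K := 1) ?_)
    refine LipschitzOnWith.of_dist_le_mul fun s hs t ht => ?_
    rw [NNReal.coe_one, one_mul, Real.dist_eq]
    exact MetricGraphStruct.dist_opar_le o ⟨hs.1, hs.2.trans hlen.le⟩ ⟨ht.1, ht.2.trans hlen.le⟩
  obtain ⟨γ, hγ⟩ := joinedIn_near_image hX hη hk hB
    ⟨0, ⟨le_rfl, by linarith⟩, rfl⟩ ⟨8 * ε, ⟨by linarith, le_rfl⟩, rfl⟩
  have hq : Continuous γ.extend := γ.continuous_extend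
  have hlevq : Continuous fun t => dist r (γ.extend t) := continuous_const.dist hq
  have h0 : dist (f r) v - 4 * ε < dist r (γ.extend 0) := by
    rw [γ.extend_zero, ho]
    linarith [(abs_lt.1 (hfk r v)).2]
  have h1 : dist r (γ.extend 1) < dist (f r) v - 4 * ε := by
    rw [γ.extend_one]
    have := (abs_lt.1 (hfk r (M.opar o (8 * ε)))).1
    rw [hdesc (8 * ε) ⟨by linarith, le_rfl⟩] at this
    linarith
  have hK : IsCompact (Icc 0 1 ∩ {t | dist r (γ.extend t) ≤ dist (f r) v - 4 * ε}) :=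
    isCompact_Icc.inter_right (isClosed_le hlevq continuous_const)
  obtain ⟨T, ⟨hT, hTlev⟩, hTmin⟩ := hK.exists_isLeast ⟨1, ⟨zero_le_one, le_rfl⟩, h1.le⟩
  have hbefore : ∀ t ∈ Ico 0 T, dist (f r) v - 4 * ε < dist r (γ.extend t) := by
    intro t ht
    by_contra hcon
    exact absurd (hTmin ⟨⟨ht.1, ht.2.le.trans hT.2⟩, not_lt.1 hcon⟩) (not_le.2 ht.2)
  have hT0 : 0 < T := by
    refine lt_of_le_of_ne hT.1 ?_
    rintro rfl
    exact absurd hTlev (not_le.2 h0)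
  have hcl : Icc 0 T ⊆ {t | dist (f r) v - 4 * ε ≤ dist r (γ.extend t)} := by
    rw [← closure_Ico hT0.ne]
    exact (isClosed_le continuous_const hlevq).closure_subset_iff.2 fun t ht => (hbefore t ht).le
  refine ⟨γ.extend, T, hq, hT.1, by rw [γ.extend_zero, ho],
    le_antisymm hTlev (hcl ⟨hT.1, le_rfl⟩), hbefore, fun t => ?_⟩
  obtain ⟨_, ⟨s, hs, rfl⟩, hd⟩ := hγ (projIcc 0 1 zero_le_one t)
  exact ⟨s, hs, hd⟩

end Spine

/-- A family of disjoint descending edge segments of length `8ε` in `Y`, issued from points of a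
preconnected set disjoint from these segments, has at most `β₁ + 1` elements, where `β₁` is the
first Betti number of the Reeb graph of a space at Gromov-Hausdorff distance less than `ε`. -/
theorem card_spines_le {G : Type*} [MetricSpace G] (R : ReebGraphOf X r G)
    (hX : IsGeodesicSpace X) (hε : 0 < ε) (hη : 0 < η)
    (hf : ∀ x x', dist x x' < η → dist (f x) (f x') < 2 * ε)
    (hk : ∀ y y', dist y y' < η → dist (k y) (k y') < 2 * ε)
    (hfk : ∀ x y, |dist (f x) y - dist x (k y)| < 2 * ε)
    (hff : ∀ x x', |dist (f x) (f x') - dist x x'| < 2 * ε)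
    {ι : Type*} [Finite ι] {v : ι → Y} {o : ι → M.E × Bool}
    (ho : ∀ i, M.opar (o i) 0 = v i) (hlen : ∀ i, 8 * ε < M.len (o i).1)
    (hdesc : ∀ i, ∀ τ ∈ Icc 0 (8 * ε), dist (f r) (M.opar (o i) τ) = dist (f r) (v i) - τ)
    (hpos : ∀ i, 9 * ε < dist (f r) (v i))
    (hdisj : ∀ i j, i ≠ j → ∀ σ ∈ Ioo 0 (8 * ε), ∀ τ ∈ Icc 0 (8 * ε),
      M.opar (o i) σ ≠ M.opar (o j) τ)
    {A : Set Y} (hA : IsPreconnected A) (hvA : ∀ i, v i ∈ A)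
    (hAdisj : ∀ i, ∀ σ ∈ Ioo 0 (8 * ε), M.opar (o i) σ ∉ A) :
    Nat.card ι ≤ R.graph.betti1 + 1 := by
  choose q T hq hT hq0 hqT hqlt hqnear using fun i =>
    exists_path_to_level hX hε hη hk hfk (ho i) (hlen i) (hdesc i)
  have hz : ∀ i, ∃ δ ∈ Ioo (2 * ε) (6 * ε), f (q i (T i)) = M.opar (o i) δ := by
    intro i
    obtain ⟨s, hs, hd⟩ := hqnear i (T i)
    exact exists_mem_spine_of_near hfk hff (ho i) (hlen i) (hdesc i) hs hd (hqT i)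
  have hfib : ∀ i z, R.π z = R.π (q i (T i)) → dist r z = dist (f r) (v i) - 4 * ε ∧
      ∃ δ ∈ Ioo (2 * ε) (6 * ε), f z = M.opar (o i) δ := by
    intro i z h
    have hrel := (R.eq_iff _ _).1 h.symm
    exact ⟨hrel.1.symm.trans (hqT i), exists_mem_spine_of_reebRel hε hη hf hff (hlen i) (hdesc i)
      (hqT i) (hz i) hrel⟩
  have havoid : ∀ i z a, dist z (k a) < ε → (∀ σ ∈ Ioo 0 (8 * ε), M.opar (o i) σ ≠ a) →
      R.π z ≠ R.π (q i (T i)) := by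
    intro i z a hza ha h
    obtain ⟨σ, hσ, rfl⟩ := near_mem_spine hfk (ho i) (hlen i) (hdesc i) hza (hfib i z h).1
      (hfib i z h).2
    exact ha σ hσ rfl
  refine R.card_le_betti1_add_one hX (P := fun i => R.π (q i (T i))) (fun i => ?_) ?_ ?_
  · rw [R.dStar_π, hqT]
    linarith [hpos i]
  · intro i j hij
    by_contra hne
    obtain ⟨δ, hδ, h1⟩ := hz i
    obtain ⟨-, δ', hδ', h2⟩ := hfib j _ hij
    exact hdisj i j hne δ ⟨by linarith [hδ.1], by linarith [hδ.2]⟩ δ'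
      ⟨by linarith [hδ'.1], by linarith [hδ'.2]⟩ (h1.symm.trans h2)
  · intro Φ hΦ
    have hspine : ∀ i, Φ (R.π (k (v i))) = Φ (R.π (q i (T i))) := by
      intro i
      rw [← hq0 i]
      refine hΦ.eq_of_path (hq i) (hT i) fun s hs hP t ht => ?_
      obtain ⟨j, hj⟩ := hP
      obtain ⟨σ, hσ, hd⟩ := hqnear i s
      by_cases hji : j = i
      · subst hji
        rw [(hfib j _ hj.symm).1]
        rcases eq_or_lt_of_le ht.2 with rfl | hlt
        · exact (hqT j).ge
        · exact (hqlt j t ⟨ht.1, hlt⟩).le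
      · exact absurd hj.symm (havoid j _ _ hd fun τ hτ => hdisj j i hji τ hτ σ hσ)
    have hjoin : ∀ i j, Φ (R.π (k (v i))) = Φ (R.π (k (v j))) := by
      intro i j
      obtain ⟨γ, hγ⟩ := joinedIn_near_image hX hη hk hA (hvA i) (hvA j)
      have := hΦ.eq_of_path γ.continuous_extend zero_le_one fun s hs hP t ht => by
        obtain ⟨l, hl⟩ := hP
        obtain ⟨a, ha, hd⟩ := hγ (projIcc 0 1 zero_le_one s)
        exact absurd hl.symm (havoid l _ a hd fun τ hτ h => hAdisj l τ hτ (h ▸ ha))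
      rwa [γ.extend_zero, γ.extend_one] at this
    intro i j
    rw [← hspine i, ← hspine j]
    exact hjoin i j

end ReebGraphOf

namespace MetricGraphStruct

variable {G : Type*} [MetricSpace G] {M : MetricGraphStruct G}

section Descending

variable {a : G} {ι : Type*} {v : ι → G} {o : ι → M.E × Bool} {c : ℝ}

/-- At most one short edge descends from each of several points to its other end. -/
theorem card_short_le (hv : Function.Injective v) (ho : ∀ i, M.opar (o i) 0 = v i)
    (hlen : ∀ i, M.len (o i).1 ≤ c)
    (hdesc : ∀ i, ∀ τ ∈ Icc 0 (M.len (o i).1), dist a (M.opar (o i) τ) = dist a (v i) - τ) :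
    Nat.card ι ≤ M.NE c := by
  have := M.fintypeE
  refine Nat.card_le_card_of_injective
    (fun i => (⟨(o i).1, hlen i⟩ : {e : M.E // M.len e ≤ c})) fun i j hij => hv ?_
  have he : (o i).1 = (o j).1 := congrArg Subtype.val hij
  by_cases hb : (o i).2 = (o j).2
  · rw [← ho i, ← ho j, Prod.ext he hb]
  · have hoj : o j = ((o i).1, !(o i).2) := by
      refine Prod.ext he.symm ?_
      cases h1 : (o i).2 <;> cases h2 : (o j).2 <;> simp_all
    have hl := M.len_pos (o i).1
    have h1 := hdesc i _ ⟨hl.le, le_rfl⟩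
    have h2 := hdesc j _ ⟨(M.len_pos _).le, le_rfl⟩
    rw [← he, hoj, opar_not, sub_self, ho i] at h2
    rw [← sub_zero (M.len (o i).1), ← opar_not, ← hoj, ho j] at h1
    linarith

theorem opar_ne_opar (hv : Function.Injective v) (ho : ∀ i, M.opar (o i) 0 = v i)
    (hlen : ∀ i, c < M.len (o i).1)
    (hdesc : ∀ i, ∀ τ ∈ Icc 0 c, dist a (M.opar (o i) τ) = dist a (v i) - τ) {i j : ι}
    (hij : i ≠ j) {σ τ : ℝ} (hσ : σ ∈ Ioo 0 c) (hτ : τ ∈ Icc 0 c) :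
    M.opar (o i) σ ≠ M.opar (o j) τ := by
  intro h
  rcases eq_of_opar_eq_opar ⟨hσ.1, hσ.2.trans (hlen i)⟩ ⟨hτ.1, hτ.2.trans (hlen j).le⟩ h with
    ⟨hoo, -⟩ | ⟨hoo, hτσ⟩
  · exact hij (hv (by rw [← ho i, ← ho j, hoo]))
  · have hτ0 : 0 < τ := by linarith [hlen i, hσ.2]
    have hκ : 0 < min τ (c - σ) := lt_min hτ0 (sub_pos.2 hσ.2)
    have hκ1 := min_le_left τ (c - σ)
    have hκ2 := min_le_right τ (c - σ)
    set κ := min τ (c - σ)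
    have h1 := hdesc i σ ⟨hσ.1.le, hσ.2.le⟩
    have h2 := hdesc j τ hτ
    have h3 := hdesc i (σ + κ) ⟨by linarith [hσ.1], by linarith⟩
    have h4 := hdesc j (τ - κ) ⟨by linarith, by linarith [hτ.2]⟩
    rw [← h] at h2
    rw [hoo, opar_not, hτσ, show M.len (o i).1 - (M.len (o i).1 - σ - κ) = σ + κ by ring] at h4
    linarith

end Descending

section Reduced

variable {a : G} {b : ℕ → G} {m : ℕ}

theorem isPreconnected_iUnion_monoSegment
    (hmono : ∀ i < m, M.MonoEdge a (b i) (b (i + 1))) :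
    IsPreconnected (⋃ i ∈ Set.Iio m, M.monoSegment a (b i) (b (i + 1))) :=
  IsPreconnected.biUnion_of_chain Set.ordConnected_Iio
    (fun _ _ => MonoEdge.isPreconnected_monoSegment)
    fun i hi hi' => ⟨b (i + 1), (hmono i hi).right_mem, (hmono (i + 1) hi').left_mem⟩

theorem eq_or_eq_of_monoEdge (hnot : ∀ i j, i + 2 ≤ j → j ≤ m → ¬ M.MonoEdge a (b i) (b j))
    {i j : ℕ} (hi : i ≤ m) (hj : j ≤ m) (h : M.MonoEdge a (b i) (b j)) :
    j = i ∨ j = i + 1 ∨ i = j + 1 := by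
  by_contra! hne
  rcases lt_or_gt_of_ne hne.1 with hlt | hlt
  · exact hnot j i (by lia) hi h.symm
  · exact hnot i j (by lia) hj h

end Reduced

end MetricGraphStruct

namespace ReebGraphOf

variable {X Y : Type*} [MetricSpace X] [MetricSpace Y] {r : X} {M : MetricGraphStruct Y}
  {f : X → Y} {k : Y → X} {ε η : ℝ}

open MetricGraphStruct

/-- The number of strict local minima of the distance to `f r` along a reduced chain. -/
theorem card_local_min_le {G : Type*} [MetricSpace G] (R : ReebGraphOf X r G)
    (hX : IsGeodesicSpace X) (hε : 0 < ε) (hη : 0 < η)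
    (hf : ∀ x x', dist x x' < η → dist (f x) (f x') < 2 * ε)
    (hk : ∀ y y', dist y y' < η → dist (k y) (k y') < 2 * ε)
    (hfk : ∀ x y, |dist (f x) y - dist x (k y)| < 2 * ε)
    (hff : ∀ x x', |dist (f x) (f x') - dist x x'| < 2 * ε)
    {b : ℕ → Y} {m : ℕ} (hmono : ∀ i < m, M.MonoEdge (f r) (b i) (b (i + 1)))
    (hnot : ∀ i j, i + 2 ≤ j → j ≤ m → ¬ M.MonoEdge (f r) (b i) (b j))
    (hpos : ∀ i ≤ m, 9 * ε < dist (f r) (b i)) :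
    ((Finset.range m).filter fun i => 0 < i ∧ dist (f r) (b i) < dist (f r) (b (i - 1)) ∧
      dist (f r) (b i) < dist (f r) (b (i + 1))).card ≤ M.NE (8 * ε) + (R.graph.betti1 + 1) := by
  classical
  set I := (Finset.range m).filter fun i => 0 < i ∧ dist (f r) (b i) < dist (f r) (b (i - 1)) ∧
      dist (f r) (b i) < dist (f r) (b (i + 1)) with hI
  have hmem : ∀ i : I, (i : ℕ) < m ∧ 0 < (i : ℕ) ∧ dist (f r) (b i) < dist (f r) (b (i - 1)) ∧
      dist (f r) (b i) < dist (f r) (b (i + 1)) := fun i => by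
    have := i.2
    simpa only [hI, Finset.mem_filter, Finset.mem_range] using this
  have hnbr : ∀ (i : I) (j : ℕ), j ≤ m → M.MonoEdge (f r) (b i) (b j) →
      dist (f r) (b j) ≤ dist (f r) (b i) → j = i := by
    intro i j hj h hle
    obtain ⟨him, hi0, hi1, hi2⟩ := hmem i
    rcases eq_or_eq_of_monoEdge hnot him.le hj h with h | h | h
    · exact h
    · rw [h] at hle; exact absurd hi2 (not_lt.2 hle)
    · rw [show (i : ℕ) - 1 = j by lia] at hi1; exact absurd hi1 (not_lt.2 hle)
  have hinj : Function.Injective fun i : I => b i := fun i j hij => by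
    refine Subtype.ext (hnbr j i (hmem i).1.le ?_ (by simp only [hij, le_refl]))
    simp only at hij
    rw [hij]
    exact MonoEdge.refl M _ _
  have hvert : ∀ i : I, ∃ o : M.E × Bool, M.opar o 0 = b i ∧
      ∀ τ ∈ Icc 0 (min (M.len o.1) (dist (f r) (b i))),
        dist (f r) (M.opar o τ) = dist (f r) (b i) - τ := by
    intro i
    obtain ⟨him, hi0, hi1, hi2⟩ := hmem i
    have hp : 0 < dist (f r) (b i) := by linarith [hpos i him.le]
    have hprev := hmono (i - 1) (by lia)
    rw [Nat.sub_add_cancel hi0] at hprev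
    exact exists_descending_edge (notInterior_of_local_min hprev.symm (hmono i him) hi1 hi2 hp
      (hnot _ _ (by lia) (by lia))) hp
  choose o ho hdesc using hvert
  have hshort : Nat.card {i : I // M.len (o i).1 ≤ 8 * ε} ≤ M.NE (8 * ε) := by
    refine card_short_le (a := f r) (v := fun i => b i.1) (o := fun i => o i.1)
      (hinj.comp Subtype.val_injective) (fun i => ho i) (fun i => i.2) fun i τ hτ => ?_
    refine hdesc i τ ⟨hτ.1, le_min hτ.2 ?_⟩
    linarith [hτ.2, i.2, hpos i (hmem i).1.le]
  have hlong : Nat.card {i : I // ¬ M.len (o i).1 ≤ 8 * ε} ≤ R.graph.betti1 + 1 := by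
    have hdesc' : ∀ i : {i : I // ¬ M.len (o i).1 ≤ 8 * ε}, ∀ τ ∈ Icc 0 (8 * ε),
        dist (f r) (M.opar (o i) τ) = dist (f r) (b i) - τ := fun i τ hτ =>
      hdesc i τ ⟨hτ.1, le_min (hτ.2.trans (not_le.1 i.2).le)
        (by linarith [hτ.2, hpos i (hmem i).1.le])⟩
    have hlen : ∀ i : {i : I // ¬ M.len (o i).1 ≤ 8 * ε}, 8 * ε < M.len (o i).1 :=
      fun i => not_le.1 i.2
    refine R.card_spines_le hX hε hη hf hk hfk hff
      (ι := {i : I // ¬ M.len (o i).1 ≤ 8 * ε}) (v := fun i => b i.1.1)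
      (o := fun i => o i.1) (fun i => ho i) hlen hdesc' (fun i => hpos i (hmem i).1.le)
      (fun i j hij σ hσ τ hτ => opar_ne_opar (ι := {i : I // ¬ M.len (o i).1 ≤ 8 * ε})
        (v := fun i => b i.1.1) (o := fun i => o i.1)
        (hinj.comp Subtype.val_injective) (fun i => ho i) hlen hdesc' hij hσ hτ)
      (isPreconnected_iUnion_monoSegment hmono)
      (fun i => mem_iUnion₂.2 ⟨i, (hmem i).1, (hmono i (hmem i).1).left_mem⟩) ?_
    intro i σ hσ hA
    obtain ⟨j, hj, hA⟩ := mem_iUnion₂.1 hA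
    have hj : j < m := hj
    obtain ⟨z, hz, hm, hlt⟩ :=
      exists_monoEdge_lower (ho i) (hlen i).le (hdesc' i) hσ hA
    rcases hz with rfl | rfl
    · rw [hnbr i j hj.le hm hlt.le] at hlt; exact lt_irrefl _ hlt
    · rw [hnbr i (j + 1) hj hm hlt.le] at hlt; exact lt_irrefl _ hlt
  have hcard : I.card = Nat.card {i : I // M.len (o i).1 ≤ 8 * ε} +
      Nat.card {i : I // ¬ M.len (o i).1 ≤ 8 * ε} := by
    rw [← Nat.card_sum, Nat.card_congr (Equiv.sumCompl fun i : I => M.len (o i).1 ≤ 8 * ε),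
      Nat.card_eq_fintype_card, Fintype.card_coe]
  lia

end ReebGraphOf

namespace MetricGraphStruct

variable {G : Type*} [MetricSpace G] {M : MetricGraphStruct G}

theorem EdgeChain.dist_le {p q : G} {L : ℝ} (h : M.EdgeChain p q L) : dist p q ≤ L := by
  induction h with
  | refl => simp
  | step h e hs ht hq hq' ih =>
    subst hq hq'
    exact (dist_triangle _ _ _).trans (add_le_add ih (M.dist_param_le e hs ht))

/-- An edge segment avoiding `a` splits into two monotone segments. -/
theorem exists_monoEdge_split {a : G} {e : M.E} {s t : ℝ} (hs : s ∈ Icc 0 (M.len e))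
    (ht : t ∈ Icc 0 (M.len e)) (hne : ∀ u ∈ uIcc s t, M.param e u ≠ a) :
    ∃ u ∈ uIcc s t, M.MonoEdge a (M.param e s) (M.param e u) ∧
      M.MonoEdge a (M.param e u) (M.param e t) := by
  wlog hst : s ≤ t generalizing s t
  · rw [uIcc_comm] at hne ⊢
    obtain ⟨u, hu, h1, h2⟩ := this ht hs hne (le_of_not_ge hst)
    exact ⟨u, hu, h2.symm, h1.symm⟩
  rw [uIcc_of_le hst] at hne ⊢
  obtain ⟨u, hu, h1, h2⟩ := exists_peak hs ht hst hne
  have hu' : u ∈ Icc 0 (M.len e) := ⟨hs.1.trans hu.1, hu.2.trans ht.2⟩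
  refine ⟨u, hu, ⟨e, s, hs, u, hu', rfl, rfl, ?_⟩, ⟨e, u, hu', t, ht, rfl, rfl, ?_⟩⟩
  · rw [h1]; congr 1; ring
  · rw [h2, abs_sub_comm]; congr 1; ring

variable (M) in
/-- One monotone step in a metric graph, recorded together with a reference height `n.2.1` close
to the distance to `a`, and a clock `n.2.2` running at least as fast as the reference height
varies. -/
def NodeStep (a : G) (ε : ℝ) (n n' : G × ℝ × ℝ) : Prop :=
  |n'.2.1 - n.2.1| ≤ n'.2.2 - n.2.2 ∧ M.MonoEdge a n.1 n'.1 ∧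
    (|dist a n'.1 - n'.2.1| < 3 * ε ∧ 9 * ε < dist a n'.1)

/-- Short chains of edges decompose into monotone steps. -/
theorem EdgeChain.reflTransGen_nodeStep {a p p' q : G} {ε L : ℝ} {c c' : ℝ × ℝ}
    (h : M.EdgeChain p q L) (hL : L + dist q p' < 2 * ε)
    (hc : |c'.1 - c.1| ≤ c'.2 - c.2) (hp : |dist a p - c.1| < 2 * ε)
    (hp' : |dist a p' - c'.1| < 2 * ε) (hc₁ : 12 * ε ≤ c.1) (hc₂ : 12 * ε ≤ c'.1) :
    Relation.ReflTransGen (M.NodeStep a ε) (p, c) (q, if L < ε then c else c') := by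
  have hε : 0 < ε := by linarith [h.nonneg, dist_nonneg (x := q) (y := p')]
  have hgood : ∀ w l, dist p w ≤ l → l + dist w p' < 2 * ε →
      |dist a w - (if l < ε then c else c').1| < 3 * ε ∧ 9 * ε < dist a w := by
    intro w l h1 h2
    have h3 := abs_le.1 (abs_dist_sub_dist_le a p w)
    have h4 := abs_le.1 (abs_dist_sub_dist_le a w p')
    have h5 := abs_lt.1 hp
    have h6 := abs_lt.1 hp'
    split_ifs with hl
    · exact ⟨abs_lt.2 ⟨by linarith, by linarith⟩, by linarith⟩
    · exact ⟨abs_lt.2 ⟨by linarith, by linarith⟩, by linarith⟩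
  have hlab : ∀ l l', l ≤ l' → |(if l' < ε then c else c').1 - (if l < ε then c else c').1| ≤
      (if l' < ε then c else c').2 - (if l < ε then c else c').2 := by
    intro l l' hll
    by_cases h1 : l' < ε
    · rw [if_pos h1, if_pos (hll.trans_lt h1)]; simp
    · by_cases h2 : l < ε
      · rwa [if_neg h1, if_pos h2]
      · rw [if_neg h1, if_neg h2]; simp
  induction h with
  | refl => rw [if_pos hε]
  | @step q q' L h e s t hs ht hq hq' ih =>
    subst hq hq'
    have hw : ∀ u ∈ uIcc s t, u ∈ Icc 0 (M.len e) ∧ |s - u| + |u - t| = |s - t| ∧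
        dist p (M.param e u) ≤ L + |s - u| ∧ L + |s - u| + dist (M.param e u) p' < 2 * ε := by
      intro u hu
      have hu' : u ∈ Icc 0 (M.len e) := uIcc_subset_Icc hs ht hu
      have hsum : |s - u| + |u - t| = |s - t| := by
        rcases mem_uIcc.1 hu with ⟨h, h'⟩ | ⟨h, h'⟩
        · rw [abs_of_nonpos (by linarith), abs_of_nonpos (by linarith : u - t ≤ 0),
            abs_of_nonpos (by linarith)]; ring
        · rw [abs_of_nonneg (by linarith), abs_of_nonneg (by linarith : 0 ≤ u - t),
            abs_of_nonneg (by linarith)]; ring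
      refine ⟨hu', hsum, (h.step e hs hu' rfl rfl).dist_le, ?_⟩
      have h1 := M.dist_param_le e hu' ht
      have h2 := dist_triangle (M.param e u) (M.param e t) p'
      linarith
    obtain ⟨u, hu, h1, h2⟩ := exists_monoEdge_split (a := a) hs ht fun u hu hua => by
      obtain ⟨-, -, h1, h2⟩ := hw u hu
      have h3 := (hgood _ _ h1 h2).2
      rw [hua, dist_self] at h3
      linarith
    obtain ⟨-, hsum, hu1, hu2⟩ := hw u hu
    obtain ⟨-, -, ht1, ht2⟩ := hw t right_mem_uIcc
    obtain ⟨-, -, -, hs2⟩ := hw s left_mem_uIcc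
    rw [sub_self, abs_zero, add_zero] at hs2
    have hpu := abs_nonneg (s - u)
    have hpt := abs_nonneg (u - t)
    have hch : Relation.ReflTransGen (M.NodeStep a ε) (p, c)
        (M.param e u, if L + |s - u| < ε then c else c') :=
      (ih hs2).tail ⟨hlab _ _ (by linarith), h1, hgood _ _ hu1 hu2⟩
    exact hch.tail
      ⟨hlab _ _ (by linarith), h2, hgood _ _ ht1 ht2⟩

end MetricGraphStruct

namespace ReebGraphOf

open MetricGraphStruct

variable {X Y : Type*} [MetricSpace X] [MetricSpace Y] {r : X} {M : MetricGraphStruct Y}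
  {f : X → Y} {ε η : ℝ}

theorem LevelStep.reflTransGen_nodeStep (hε : 0 < ε)
    (hf : ∀ x x', dist x x' < η → dist (f x) (f x') < 2 * ε)
    (hff : ∀ x x', |dist (f x) (f x') - dist x x'| < 2 * ε) {a b : X × ℝ}
    (h : LevelStep r η a b) (ha : 12 * ε ≤ dist r a.1) (hb : 12 * ε ≤ dist r b.1) :
    Relation.ReflTransGen (M.NodeStep (f r) ε) (f a.1, dist r a.1, a.2)
      (f b.1, dist r b.1, b.2) := by
  obtain ⟨L, hL, hch⟩ := exists_edgeChain (M := M) (hf _ _ h.1)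
  refine (hch.reflTransGen_nodeStep (p' := f b.1) (c' := (dist r b.1, b.2)) (by simpa using hL)
    h.2 (hff _ _) (hff _ _) ha hb).tail ⟨?_, MonoEdge.refl M _ _, ?_⟩
  · have h2 := h.2
    split_ifs
    · exact h2
    · simp
  · have h3 := hff r b.1
    have h4 := abs_lt.1 h3
    exact ⟨by linarith, by dsimp only; linarith⟩

/-- A discrete path in `X` of controlled level variation either lifts to a chain of monotone
steps, or it goes near `r`. -/
theorem levelChain_lift (hε : 0 < ε)
    (hf : ∀ x x', dist x x' < η → dist (f x) (f x') < 2 * ε)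
    (hff : ∀ x x', |dist (f x) (f x') - dist x x'| < 2 * ε) {x : X} {b : X × ℝ}
    (h : Relation.ReflTransGen (LevelStep r η) (x, 0) b) :
    |dist r b.1 - dist r x| ≤ b.2 ∧
      ((12 * ε ≤ dist r x ∧ Relation.ReflTransGen (M.NodeStep (f r) ε) (f x, dist r x, 0)
        (f b.1, dist r b.1, b.2)) ∨ dist r x + dist r b.1 - 24 * ε ≤ b.2) := by
  induction h with
  | refl =>
    refine ⟨by simp, ?_⟩
    rcases le_or_gt (12 * ε) (dist r x) with h | h
    · exact Or.inl ⟨h, .refl⟩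
    · exact Or.inr (by dsimp only; linarith)
  | @tail b c _ hbc ih =>
    obtain ⟨h1, h2⟩ := ih
    have h3 := abs_le.1 h1
    have h4 := abs_le.1 hbc.2
    refine ⟨abs_le.2 ⟨by linarith, by linarith⟩, ?_⟩
    rcases h2 with ⟨hx, hch⟩ | h2
    · by_cases hb : 12 * ε ≤ dist r b.1
      · by_cases hc : 12 * ε ≤ dist r c.1
        · exact Or.inl ⟨hx, hch.trans (hbc.reflTransGen_nodeStep hε hf hff hb hc)⟩
        · right; linarith
      · right; linarith
    · right; linarith

end ReebGraphOf

namespace ReebGraphOf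

open MetricGraphStruct

variable {X Y : Type*} [MetricSpace X] [MetricSpace Y] {r : X} {M : MetricGraphStruct Y}
  {f : X → Y} {k : Y → X} {ε η : ℝ}

/-- A chain of monotone steps bounds the distance of its extremities, up to an error controlled by
the topology of the Reeb graph and the number of short edges. -/
theorem dist_image_le_of_nodeStep {G : Type*} [MetricSpace G] (R : ReebGraphOf X r G)
    (hX : IsGeodesicSpace X) (hε : 0 < ε) (hη : 0 < η)
    (hf : ∀ x x', dist x x' < η → dist (f x) (f x') < 2 * ε)
    (hk : ∀ y y', dist y y' < η → dist (k y) (k y') < 2 * ε)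
    (hfk : ∀ x y, |dist (f x) y - dist x (k y)| < 2 * ε)
    (hff : ∀ x x', |dist (f x) (f x') - dist x x'| < 2 * ε) {x y : X} {L : ℝ}
    (hx : 12 * ε ≤ dist r x) (hL : |dist r y - dist r x| ≤ L)
    (h : Relation.ReflTransGen (M.NodeStep (f r) ε) (f x, dist r x, 0) (f y, dist r y, L)) :
    dist (f x) (f y) ≤ L + 12 * ε * (M.NE (8 * ε) + (R.graph.betti1 + 1) : ℕ) + 10 * ε := by
  have hcx := hff r x
  have hcy := hff r y
  obtain ⟨m, N, h0, hm, hT, hmono, hp, hnot⟩ :=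
    Relation.ReflTransGen.exists_reduced_chain
      (T := fun n n' : Y × ℝ × ℝ => |n'.2.1 - n.2.1| ≤ n'.2.2 - n.2.2)
      (Mo := fun n n' => M.MonoEdge (f r) n.1 n'.1)
      (p := fun n => |dist (f r) n.1 - n.2.1| < 3 * ε ∧ 9 * ε < dist (f r) n.1)
      (fun n n' n'' h1 h2 => by
        have h3 := abs_sub_le n''.2.1 n'.2.1 n.2.1
        linarith)
      (by
        have := abs_lt.1 hcx
        exact ⟨by dsimp only; linarith, by dsimp only; linarith⟩)
      h
  rcases le_or_gt m 1 with hm1 | hm2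
  · have hmo : M.MonoEdge (f r) (f x) (f y) := by
      interval_cases m
      · have := congrArg Prod.fst (h0.symm.trans hm)
        simp only at this
        rw [this]
        exact MonoEdge.refl M _ _
      · have := hmono 0 one_pos
        rwa [h0, zero_add, hm] at this
    have h1 := hmo.dist_le
    have h2 : |dist (f r) (f x) - dist (f r) (f y)| ≤ L + 4 * ε := by
      have h3 := abs_lt.1 hcx
      have h4 := abs_lt.1 hcy
      have h5 := abs_le.1 hL
      exact abs_le.2 ⟨by linarith, by linarith⟩
    have h3 : 0 ≤ 12 * ε * (M.NE (8 * ε) + (R.graph.betti1 + 1) : ℕ) := by positivity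
    linarith
  · have hne : ∀ i < m, dist (f r) (N i).1 ≠ dist (f r) (N (i + 1)).1 := by
      intro i hi heq
      have hNN := (hmono i hi).eq_of_dist_eq heq
      rcases Nat.lt_or_ge (i + 1) m with hlt | hge
      · refine hnot i (i + 2) le_rfl hlt ?_
        rw [hNN]
        exact hmono (i + 1) hlt
      · refine hnot (i - 1) (i + 1) (by lia) hi ?_
        rw [← hNN]
        have := hmono (i - 1) (by lia)
        rwa [Nat.sub_add_cancel (by lia)] at this
    have hsum := sum_abs_sub_le_of_close (h := fun i => dist (f r) (N i).1)
      (H := fun i => (N i).2.1) (ℓ := fun i => (N i).2.2) (ε := ε) (m := m) (by lia) hne hT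
      (fun i hi => (hp i hi).1.le) (by rw [h0]; exact hcx.le) (by rw [hm]; exact hcy.le)
    have hcard := R.card_local_min_le hX hε hη hf hk hfk hff (b := fun i => (N i).1) hmono hnot
      fun i hi => (hp i hi).2
    have hd := dist_le_range_sum_dist (fun i => (N i).1) m
    have hle : ∑ i ∈ Finset.range m, dist (N i).1 (N (i + 1)).1 ≤
        ∑ i ∈ Finset.range m, |dist (f r) (N i).1 - dist (f r) (N (i + 1)).1| :=
      Finset.sum_le_sum fun i hi => (hmono i (Finset.mem_range.1 hi)).dist_le
    simp only [h0, hm] at hd hsum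
    refine hd.trans (hle.trans (hsum.trans ?_))
    rw [sub_zero]
    gcongr

theorem dist_le_dist_π_add {G : Type*} [MetricSpace G] [CompactSpace X] (R : ReebGraphOf X r G)
    (hX : IsGeodesicSpace X) (hε : 0 < ε) (hη : 0 < η)
    (hf : ∀ x x', dist x x' < η → dist (f x) (f x') < 2 * ε)
    (hk : ∀ y y', dist y y' < η → dist (k y) (k y') < 2 * ε)
    (hfk : ∀ x y, |dist (f x) y - dist x (k y)| < 2 * ε)
    (hff : ∀ x x', |dist (f x) (f x') - dist x x'| < 2 * ε) (x y : X) :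
    dist x y ≤ dist (R.π x) (R.π y) +
      12 * ε * ((M.NE (8 * ε) : ℝ) + R.graph.betti1 + 2) := by
  refine le_of_forall_gt_imp_ge_of_dense fun C hC => ?_
  obtain ⟨L, hL, hch⟩ := R.exists_levelChain hX hη
    (lt_sub_iff_add_lt.2 hC : dist (R.π x) (R.π y) <
      C - 12 * ε * ((M.NE (8 * ε) : ℝ) + R.graph.betti1 + 2))
  have hnonneg : 0 ≤ 12 * ε * ((M.NE (8 * ε) : ℝ) + R.graph.betti1) := by positivity
  obtain ⟨hd, ⟨hx, h⟩ | h⟩ := levelChain_lift (M := M) hε hf hff hch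
  · have h1 := R.dist_image_le_of_nodeStep hX hε hη hf hk hfk hff hx hd h
    have h2 := (abs_lt.1 (hff x y)).1
    push_cast at h1
    linarith
  · have h1 := dist_triangle_left x y r
    dsimp only at h
    linarith

end ReebGraphOf

theorem exists_correspondence {X Y : Type*} [MetricSpace X] [CompactSpace X] [Nonempty X]
    [MetricSpace Y] [CompactSpace Y] [Nonempty Y] {ε : ℝ}
    (h : GromovHausdorff.ghDist X Y < ε) : ∃ (f : X → Y) (k : Y → X),
      (∀ x x', |dist (f x) (f x') - dist x x'| < 2 * ε) ∧
      (∀ y y', |dist (k y) (k y') - dist y y'| < 2 * ε) ∧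
      ∀ x y, |dist (f x) y - dist x (k y)| < 2 * ε := by
  obtain ⟨Φ, Ψ, hΦ, hΨ, hd⟩ := GromovHausdorff.ghDist_eq_hausdorffDist X Y
  rw [hd] at h
  have hfin := hausdorffEDist_ne_top_of_nonempty_of_bounded (range_nonempty Φ) (range_nonempty Ψ)
    (isCompact_range hΦ.continuous).isBounded (isCompact_range hΨ.continuous).isBounded
  have hf : ∀ x, ∃ y, dist (Φ x) (Ψ y) < ε := fun x => by
    obtain ⟨_, ⟨y, rfl⟩, hy⟩ := exists_dist_lt_of_hausdorffDist_lt (mem_range_self x) h hfin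
    exact ⟨y, hy⟩
  have hk : ∀ y, ∃ x, dist (Φ x) (Ψ y) < ε := fun y => by
    obtain ⟨_, ⟨x, rfl⟩, hx⟩ := exists_dist_lt_of_hausdorffDist_lt' (mem_range_self y) h hfin
    exact ⟨x, hx⟩
  choose f hf using hf
  choose k hk using hk
  have key : ∀ x x' y y', dist (Φ x) (Ψ y) < ε → dist (Φ x') (Ψ y') < ε →
      |dist x x' - dist y y'| < 2 * ε := by
    intro x x' y y' h1 h2
    rw [← hΦ.dist_eq, ← hΨ.dist_eq, ← Real.dist_eq]
    exact (dist_dist_dist_le _ _ _ _).trans_lt (by linarith)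
  refine ⟨f, k, fun x x' => ?_, fun y y' => key _ _ _ _ (hk y) (hk y'), fun x y => ?_⟩
  · rw [abs_sub_comm]; exact key _ _ _ _ (hf x) (hf x')
  · rw [abs_sub_comm]; exact key _ _ _ _ (hf x) (hk y)

/-- If a compact connected geodesic space `X` is at Gromov-Hausdorff distance `< ε` from
some finite metric graph `G'`, then the metric Reeb graph `G` of `d = d_X(r,·)` satisfies
`d_GH(X,G) < (β₁(G)+1)(17 + 8 N_{E,G'}(8ε)) ε`, where `N_{E,G'}(8ε)` is the number of
edges of `G'` of length at most `8ε`. In particular if every edge of `G'` is longer than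
`8ε` then `d_GH(X,G) < 17 (β₁(G)+1) ε`. -/
theorem ghDist_reeb_of_close_to_graph {X : Type*} [MetricSpace X] [CompactSpace X]
    [Nonempty X] [ConnectedSpace X] (hX : IsGeodesicSpace X) (r : X)
    {G : Type*} [MetricSpace G] [CompactSpace G] [Nonempty G] (R : ReebGraphOf X r G)
    {G' : Type*} [MetricSpace G'] [CompactSpace G'] [Nonempty G'] [ConnectedSpace G']
    (M' : MetricGraphStruct G') (ε : ℝ) (hε : 0 < ε)
    (hGH : GromovHausdorff.ghDist X G' < ε) :
    GromovHausdorff.ghDist X G <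
      ((R.graph.betti1 : ℝ) + 1) * (17 + 8 * (M'.NE (8 * ε) : ℝ)) * ε ∧
    ((∀ e : M'.E, 8 * ε < M'.len e) →
      GromovHausdorff.ghDist X G < 17 * ((R.graph.betti1 : ℝ) + 1) * ε) := by
  obtain ⟨ε₁, hε₁, hlt⟩ := exists_between hGH
  obtain ⟨f, k, hff, hkk, hfk⟩ := exists_correspondence hε₁
  have hclose : ∀ x y, |dist x y - dist (R.π x) (R.π y)| ≤
      12 * ε * ((M'.NE (8 * ε) : ℝ) + R.graph.betti1 + 2) := by
    intro x y
    rw [abs_of_nonneg (sub_nonneg.2 (R.dist_π_le hX x y)), sub_le_iff_le_add']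
    refine R.dist_le_dist_π_add hX hε (η := 2 * (ε - ε₁)) (f := f) (k := k) (by linarith)
      (fun x x' h => ?_) (fun y y' h => ?_) (fun x y => (hfk x y).trans (by linarith))
      (fun x x' => (hff x x').trans (by linarith)) x y
    · linarith [(abs_lt.1 (hff x x')).2]
    · linarith [(abs_lt.1 (hkk y y')).2]
  have hbound : GromovHausdorff.ghDist X G ≤
      6 * ε * ((M'.NE (8 * ε) : ℝ) + R.graph.betti1 + 2) := by
    have h := GromovHausdorff.ghDist_le_of_approx_subsets (s := (univ : Set X))
      (ε₁ := 0) (ε₃ := 0) (fun x => R.π x) (fun x => ⟨x, mem_univ x, by simp⟩)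
      (fun g => by
        obtain ⟨x, rfl⟩ := R.surj g
        exact ⟨⟨x, mem_univ x⟩, by simp⟩)
      (fun x y => hclose x y)
    linarith
  have hb : (0 : ℝ) ≤ R.graph.betti1 := Nat.cast_nonneg _
  have hN : (0 : ℝ) ≤ M'.NE (8 * ε) := Nat.cast_nonneg _
  have hmain : GromovHausdorff.ghDist X G <
      ((R.graph.betti1 : ℝ) + 1) * (17 + 8 * (M'.NE (8 * ε) : ℝ)) * ε := by
    refine hbound.trans_lt ?_
    nlinarith [mul_nonneg hb hN, mul_nonneg hε.le hb, mul_nonneg hε.le hN,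
      mul_nonneg hε.le (mul_nonneg hb hN)]
  refine ⟨hmain, fun hlong => ?_⟩
  have h0 : M'.NE (8 * ε) = 0 := by
    have : IsEmpty {e : M'.E // M'.len e ≤ 8 * ε} := ⟨fun e => absurd e.2 (not_le.2 (hlong e))⟩
    exact Nat.card_of_isEmpty
  rw [h0] at hmain
  push_cast at hmain
  linarith
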